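/- For all n ≥ 1: (i) depth R/(I+J)^n ≥ min_{i+j ≤ n−1, i,j ≥ 0} { depth I^i/I^{i+1} + depth J^j/J^{j+1} }, and (ii) reg R/(I+J)^n ≤ max_{i+j ≤ n−1, i,j ≥ 0} { reg I^i/I^{i+1} + reg J^j/J^{j+1} }, where I^i/I^{i+1} is regarded as an A-module and J^j/J^{j+1} as a B-module. -/

import Mathlib

/-! Core definitions: depth via local cohomology at the maximal homogeneous ideal,
Castelnuovo–Mumford regularity via graded free resolutions, gradings on
subquotients of polynomial rings.  -/

open MvPolynomial

noncomputable section

namespace PaperHTT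

variable (k : Type) [Field k]

/-- A polynomial is homogeneous of degree `e : ℤ` (it must vanish in negative degrees). -/
def homogZ {σ : Type} (p : MvPolynomial σ k) (e : ℤ) : Prop :=
  p = 0 ∨ (0 ≤ e ∧ p.IsHomogeneous e.toNat)

/-- The maximal homogeneous ideal `(x_1, …, x_r)` of a polynomial ring. -/
def maxHomIdeal (σ : Type) : Ideal (MvPolynomial σ k) :=
  Ideal.span (Set.range MvPolynomial.X)

/-- The depth of a module over a polynomial ring with respect to the maximal homogeneous
ideal: the least `i` such that the `i`-th local cohomology is non-vanishing. -/
def depthM {σ : Type} (M : ModuleCat (MvPolynomial σ k)) : ℕ :=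
  sInf {i : ℕ | Nontrivial ((localCohomology (maxHomIdeal k σ) i).obj M)}

/-- The subquotient `p/q` of a polynomial ring, for ideals `q ≤ p`. -/
abbrev subQuot {σ : Type} (p q : Ideal (MvPolynomial σ k)) : Type :=
  ↥p ⧸ (Submodule.comap p.subtype q)

/-- The degree-`t` graded piece of `p/q`: the image of the homogeneous elements of
degree `t` of `p`. -/
def subQuotGr {σ : Type} (p q : Ideal (MvPolynomial σ k)) (t : ℤ) :
    AddSubgroup (subQuot k p q) :=
  AddSubgroup.closure
    {x | ∃ f : p, homogZ k (f : MvPolynomial σ k) t ∧ x = Submodule.Quotient.mk f}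

/-- The degree-`t` graded piece of the quotient ring `P/Q`. -/
def quotGr {σ : Type} (Q : Ideal (MvPolynomial σ k)) (t : ℤ) :
    AddSubgroup (MvPolynomial σ k ⧸ Q) :=
  AddSubgroup.closure {x | ∃ f, homogZ k f t ∧ x = Ideal.Quotient.mk Q f}

/-- The degree-`t` graded piece of an ideal `p`, viewed as a module. -/
def idealGr {σ : Type} (p : Ideal (MvPolynomial σ k)) (t : ℤ) : AddSubgroup ↥p :=
  AddSubgroup.closure {x : p | homogZ k (x : MvPolynomial σ k) t}

/-- A finite graded free resolution of a module `M` over a polynomial ring,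
with respect to a grading `gr` of `M`: `F_i` is free of rank `rk i`, with basis elements
of (twisted) degrees `tw i l`, the differentials and augmentation are graded of degree `0`,
and the complex `⋯ → F_1 → F_0 → M → 0` is exact. -/
structure GradedFreeRes (σ : Type) (M : Type) [AddCommGroup M]
    [Module (MvPolynomial σ k) M] (gr : ℤ → AddSubgroup M) where
  rk : ℕ → ℕ
  tw : (i : ℕ) → Fin (rk i) → ℤ
  bdd : ∃ N, ∀ i, N ≤ i → rk i = 0
  aug : (Fin (rk 0) → MvPolynomial σ k) →ₗ[MvPolynomial σ k] M
  d : (i : ℕ) →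
    ((Fin (rk (i + 1)) → MvPolynomial σ k) →ₗ[MvPolynomial σ k]
      (Fin (rk i) → MvPolynomial σ k))
  aug_surj : Function.Surjective aug
  exact_zero : LinearMap.range (d 0) = LinearMap.ker aug
  exact_succ : ∀ i, LinearMap.range (d (i + 1)) = LinearMap.ker (d i)
  aug_homog : ∀ l, aug (Pi.single l 1) ∈ gr (tw 0 l)
  d_homog : ∀ i l l', homogZ k (d i (Pi.single l 1) l') (tw (i + 1) l - tw i l')

/-- The Castelnuovo–Mumford regularity of a (finitely generated) graded module over a
polynomial ring: the least `r` such that `M` admits a graded free resolution with all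
twists in homological degree `i` at most `r + i`.  (By minimal free resolutions, this
agrees with `max {aⁱ(M) + i}`.) -/
def regM (σ : Type) (M : Type) [AddCommGroup M] [Module (MvPolynomial σ k) M]
    (gr : ℤ → AddSubgroup M) : ℤ :=
  sInf {r : ℤ | ∃ F : GradedFreeRes k σ M gr, ∀ i (l : Fin (F.rk i)), F.tw i l - (i : ℤ) ≤ r}

/-- Depth of the quotient ring `P/Q` as a module over `P`. -/
def depthQuot {σ : Type} (Q : Ideal (MvPolynomial σ k)) : ℕ :=
  depthM k (ModuleCat.of (MvPolynomial σ k) (MvPolynomial σ k ⧸ Q))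

/-- Depth of the subquotient `p/q` as a module over the polynomial ring. -/
def depthSubQuot {σ : Type} (p q : Ideal (MvPolynomial σ k)) : ℕ :=
  depthM k (ModuleCat.of (MvPolynomial σ k) (subQuot k p q))

/-- Depth of an ideal `p` as a module over the polynomial ring. -/
def depthIdeal {σ : Type} (p : Ideal (MvPolynomial σ k)) : ℕ :=
  depthM k (ModuleCat.of (MvPolynomial σ k) ↥p)

/-- Regularity of the quotient ring `P/Q`. -/
def regQuot {σ : Type} (Q : Ideal (MvPolynomial σ k)) : ℤ :=
  regM k σ (MvPolynomial σ k ⧸ Q) (quotGr k Q)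

/-- Regularity of the subquotient `p/q`. -/
def regSubQuot {σ : Type} (p q : Ideal (MvPolynomial σ k)) : ℤ :=
  regM k σ (subQuot k p q) (subQuotGr k p q)

/-- Regularity of an ideal `p`, viewed as a graded module. -/
def regIdeal {σ : Type} (p : Ideal (MvPolynomial σ k)) : ℤ :=
  regM k σ (↥p) (idealGr k p)

/-- A homogeneous ideal: one containing all homogeneous components of its elements. -/
def IsHomogeneousIdeal {σ : Type} (I : Ideal (MvPolynomial σ k)) : Prop :=
  ∀ f ∈ I, ∀ m : ℕ, MvPolynomial.homogeneousComponent m f ∈ I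

/-- A monomial ideal. -/
def IsMonomialIdeal {σ : Type} (I : Ideal (MvPolynomial σ k)) : Prop :=
  ∃ S : Set (σ →₀ ℕ), I = Ideal.span ((fun a => MvPolynomial.monomial a (1 : k)) '' S)

/-- A squarefree monomial ideal. -/
def IsSquarefreeMonomialIdeal {σ : Type} (I : Ideal (MvPolynomial σ k)) : Prop :=
  ∃ S : Set (σ →₀ ℕ), (∀ a ∈ S, ∀ x, a x ≤ 1) ∧
    I = Ideal.span ((fun a => MvPolynomial.monomial a (1 : k)) '' S)


/-- The quotient ring `P/Q` is Cohen–Macaulay: its depth equals its Krull dimension. -/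
def IsCMQuot {σ : Type} (Q : Ideal (MvPolynomial σ k)) : Prop :=
  (depthQuot k Q : WithBot (WithTop ℕ)) = ringKrullDim (MvPolynomial σ k ⧸ Q)

/-- An isomorphism of graded modules: a linear isomorphism matching up the gradings. -/
def GradedIso {P : Type} [CommRing P] {M N : Type} [AddCommGroup M] [Module P M]
    [AddCommGroup N] [Module P N] (grM : ℤ → AddSubgroup M) (grN : ℤ → AddSubgroup N) :
    Prop :=
  ∃ e : M ≃ₗ[P] N, ∀ t, (grM t).map e.toLinearMap.toAddMonoidHom = grN t

/-- `gr` is an (internal, ℤ-) grading of the module `M` over a polynomial ring,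
compatible with the standard grading of the polynomial ring. -/
def IsGrading (σ : Type) {M : Type} [AddCommGroup M] [Module (MvPolynomial σ k) M]
    (gr : ℤ → AddSubgroup M) : Prop :=
  DirectSum.IsInternal (fun t : ℤ => gr t) ∧
    ∀ (p : MvPolynomial σ k) (d : ℕ) (t : ℤ) (m : M), p.IsHomogeneous d → m ∈ gr t →
      p • m ∈ gr (t + d)

/-- The polynomial ring `A = k[x_1,…,x_r]`. -/
abbrev PA (r : ℕ) : Type := MvPolynomial (Fin r) k

/-- The polynomial ring `B = k[y_1,…,y_s]`. -/
abbrev PB (s : ℕ) : Type := MvPolynomial (Fin s) k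

/-- The polynomial ring `R = k[x_1,…,x_r,y_1,…,y_s]`. -/
abbrev PR (r s : ℕ) : Type := MvPolynomial (Fin r ⊕ Fin s) k

/-- The extension of an ideal `I ⊆ A` to `R`. -/
def extA {r s : ℕ} (I : Ideal (PA k r)) : Ideal (PR k r s) :=
  I.map (MvPolynomial.rename (Sum.inl : Fin r → Fin r ⊕ Fin s))

/-- The extension of an ideal `J ⊆ B` to `R`. -/
def extB {r s : ℕ} (J : Ideal (PB k s)) : Ideal (PR k r s) :=
  J.map (MvPolynomial.rename (Sum.inr : Fin s → Fin r ⊕ Fin s))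

/-- The ideal `I + J ⊆ R`. -/
def sumIJ {r s : ℕ} (I : Ideal (PA k r)) (J : Ideal (PB k s)) : Ideal (PR k r s) :=
  extA k I + extB k J

end PaperHTT

end

section
open CategoryTheory Limits

namespace PaperHTT

universe u

lemma iso_square {C : Type*} [Category* C] {E E' U U' H H' : C} (α : E ≅ U) (α' : E' ≅ U')
    (h : H ≅ U) (h' : H' ≅ U') (mE : E ⟶ E') (mU : U ⟶ U') (mH : H ⟶ H')
    (k2 : α.hom ≫ mU = mE ≫ α'.hom) (k3 : mH ≫ h'.hom = h.hom ≫ mU) :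
    (α ≪≫ h.symm).hom ≫ mH = mE ≫ (α' ≪≫ h'.symm).hom := by
  have : mH = h.hom ≫ mU ≫ h'.inv := by rw [← Category.assoc, ← k3]; simp
  subst this
  simp [reassoc_of% k2]

lemma homologyUnop_naturality {V : Type*} [Category* V] [Abelian V] {ι : Type*} {c : ComplexShape ι}
    {K L : HomologicalComplex Vᵒᵖ c} (φ : K ⟶ L) (i : ι) :
    HomologicalComplex.homologyMap ((HomologicalComplex.unopFunctor V c).map φ.op) i ≫
        (K.homologyUnop i).hom =
      (L.homologyUnop i).hom ≫ (HomologicalComplex.homologyMap φ i).unop := by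
  have := HomologicalComplex.homologyOp_hom_naturality
    ((HomologicalComplex.unopFunctor V c).map φ.op) i
  exact (congrArg Quiver.Hom.unop this).symm

section
variable {R : Type u} [CommRing R] {c : ComplexShape ℕ}

lemma homologyπ_surj (K : HomologicalComplex (ModuleCat.{u} R) c) (i : ℕ) (x : K.homology i) :
    ∃ z : K.cycles i, K.homologyπ i z = x :=
  (ModuleCat.epi_iff_surjective (K.homologyπ i)).1 inferInstance x

lemma iCycles_inj (K : HomologicalComplex (ModuleCat.{u} R) c) (i : ℕ) :
    Function.Injective (K.iCycles i) :=
  (ModuleCat.mono_iff_injective (K.iCycles i)).1 inferInstance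

lemma homologyπ_eq_zero (K : HomologicalComplex (ModuleCat.{u} R) c) (j i : ℕ) (hj : c.prev i = j)
    (z : K.cycles i) :
    K.homologyπ i z = 0 ↔ ∃ y : K.X j, K.d j i y = K.iCycles i z := by
  have h := ShortComplex.exact_of_g_is_cokernel
    (ShortComplex.mk (K.toCycles j i) (K.homologyπ i) (by simp)) (K.homologyIsCokernel j i hj)
  rw [ShortComplex.moduleCat_exact_iff] at h
  constructor
  · intro hz
    obtain ⟨y, hy⟩ := h z hz
    exact ⟨y, by rw [← hy]; simp [← ModuleCat.comp_apply]⟩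
  · rintro ⟨y, hy⟩
    have : z = K.toCycles j i y := by
      apply iCycles_inj
      rw [← hy]; simp [← ModuleCat.comp_apply]
    rw [this]; simp [← ModuleCat.comp_apply]

lemma exists_cycle (K : HomologicalComplex (ModuleCat.{u} R) c) (i j : ℕ) (hj : c.next i = j)
    (x : K.X i) (hx : K.d i j x = 0) : ∃ z : K.cycles i, K.iCycles i z = x := by
  have h := ShortComplex.exact_of_f_is_kernel
    (ShortComplex.mk (K.iCycles i) (K.d i j) (by simp)) (K.cyclesIsKernel i j hj)
  rw [ShortComplex.moduleCat_exact_iff] at h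
  exact h x hx

end

section
variable {R : Type u} [CommRing R] {X X' : ModuleCat.{u} R}

/-- A cochain on a projective resolution represents an element of the derived `Ext`. -/
def Represents (P : ProjectiveResolution X) (n : ℕ) (Y : ModuleCat.{u} R)
    (x : ((Ext R (ModuleCat.{u} R) n).obj (Opposite.op X)).obj Y) (f : P.complex.X n ⟶ Y) : Prop :=
  ∃ z : (P.complex.linearYonedaObj R Y).cycles n,
    (P.complex.linearYonedaObj R Y).iCycles n z = f ∧
      (P.complex.linearYonedaObj R Y).homologyπ n z = (P.isoExt n Y).hom x

variable (P : ProjectiveResolution X) (n : ℕ) (Y : ModuleCat.{u} R)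

lemma exists_represents (x : ((Ext R (ModuleCat.{u} R) n).obj (Opposite.op X)).obj Y) :
    ∃ f : P.complex.X n ⟶ Y, P.complex.d (n+1) n ≫ f = 0 ∧ Represents P n Y x f := by
  obtain ⟨z, hz⟩ := homologyπ_surj _ _ ((P.isoExt n Y).hom x)
  refine ⟨(P.complex.linearYonedaObj R Y).iCycles n z, ?_, z, rfl, hz⟩
  have : (P.complex.linearYonedaObj R Y).d n (n+1) ((P.complex.linearYonedaObj R Y).iCycles n z) = 0 := by
    rw [← ModuleCat.comp_apply, HomologicalComplex.iCycles_d]; rfl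
  exact this

lemma represents_of_cocycle (f : P.complex.X n ⟶ Y) (hf : P.complex.d (n+1) n ≫ f = 0) :
    ∃ x, Represents P n Y x f := by
  obtain ⟨z, hz⟩ := exists_cycle (P.complex.linearYonedaObj R Y) n (n+1) (by simp) f hf
  refine ⟨(P.isoExt n Y).inv ((P.complex.linearYonedaObj R Y).homologyπ n z), z, hz, ?_⟩
  rw [← ModuleCat.comp_apply, Iso.inv_hom_id]; rfl

lemma Represents.eq_zero_iff {P : ProjectiveResolution X} {n : ℕ} {Y : ModuleCat.{u} R}
    {x : ((Ext R (ModuleCat.{u} R) n).obj (Opposite.op X)).obj Y} {f : P.complex.X n ⟶ Y}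
    (h : Represents P n Y x f) :
    x = 0 ↔ ∃ (g : P.complex.X (n-1) ⟶ Y), P.complex.d n (n-1) ≫ g = f := by
  obtain ⟨z, rfl, hz⟩ := h
  have h1 : x = 0 ↔ (P.isoExt n Y).hom x = 0 := by
    constructor
    · rintro rfl; simp
    · intro h
      have := congrArg (P.isoExt n Y).inv h
      simpa [← ModuleCat.comp_apply] using this
  rw [h1, ← hz, homologyπ_eq_zero _ (n-1) n (by cases n <;> simp)]
  rfl

set_option maxHeartbeats 1000000 in
lemma Represents.map {P : ProjectiveResolution X} {n : ℕ} {Y : ModuleCat.{u} R}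
    {x : ((Ext R (ModuleCat.{u} R) n).obj (Opposite.op X)).obj Y} {f : P.complex.X n ⟶ Y}
    (h : Represents P n Y x f) (P' : ProjectiveResolution X') (a : X' ⟶ X)
    (φ : P'.complex ⟶ P.complex) (comm : φ.f 0 ≫ P.π.f 0 = P'.π.f 0 ≫ a) :
    Represents P' n Y (((Ext R (ModuleCat.{u} R) n).map a.op).app Y x) (φ.f n ≫ f) := by
  obtain ⟨z, rfl, hz⟩ := h
  let F := ((linearYoneda R (ModuleCat.{u} R)).obj Y).rightOp
  let ψ : P.complex.linearYonedaObj R Y ⟶ P'.complex.linearYonedaObj R Y :=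
    (HomologicalComplex.unopFunctor _ _).map ((F.mapHomologicalComplex _).map φ).op
  refine ⟨HomologicalComplex.cyclesMap ψ n z, ?_, ?_⟩
  · have : (HomologicalComplex.cyclesMap ψ n ≫ HomologicalComplex.iCycles _ n) z =
      (HomologicalComplex.iCycles _ n ≫ ψ.f n) z := by simp
    exact this
  · have e : (HomologicalComplex.cyclesMap ψ n ≫ HomologicalComplex.homologyπ _ n) z =
      (HomologicalComplex.homologyπ _ n ≫ HomologicalComplex.homologyMap ψ n) z := by simp
    rw [ModuleCat.comp_apply, ModuleCat.comp_apply, hz] at e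
    refine e.trans ?_
    have key : (P.isoExt n Y).hom ≫ HomologicalComplex.homologyMap ψ n =
        ((Ext R (ModuleCat.{u} R) n).map a.op).app Y ≫ (P'.isoExt n Y).hom := by
      have k1 := ProjectiveResolution.isoLeftDerivedObj_inv_naturality a P' P φ comm F n
      exact iso_square ((P.isoLeftDerivedObj F n).unop.symm) ((P'.isoLeftDerivedObj F n).unop.symm)
        (HomologicalComplex.homologyUnop _ _) (HomologicalComplex.homologyUnop _ _) _ _ _
        (congrArg Quiver.Hom.unop k1).symm
        (homologyUnop_naturality ((F.mapHomologicalComplex _).map φ) n)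
    rw [← ModuleCat.comp_apply, key, ModuleCat.comp_apply]
end

section
variable {R : Type} [CommRing R] (J : Ideal R)

/-- The chosen projective resolution of `R / J ^ t`. -/
noncomputable def powRes (t : ℕ) : ProjectiveResolution (ModuleCat.of R (R ⧸ J ^ t)) :=
  projectiveResolution _

/-- The projection `R / J ^ t' → R / J ^ t`. -/
noncomputable def powProj {t t' : ℕ} (h : t ≤ t') :
    ModuleCat.of R (R ⧸ J ^ t') ⟶ ModuleCat.of R (R ⧸ J ^ t) :=
  ModuleCat.ofHom (Submodule.mapQ _ _ LinearMap.id (Ideal.pow_le_pow_right h))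

/-- The augmentation of the chosen resolution. -/
noncomputable def powAug (t : ℕ) :
    (powRes J t).complex.X 0 ⟶ ModuleCat.of R (R ⧸ J ^ t) := (powRes J t).π.f 0

/-- A chain map lifting the projection `R / J ^ t' → R / J ^ t`. -/
structure PowLift (t t' : ℕ) where
  le : t ≤ t'
  φ : (powRes J t').complex ⟶ (powRes J t).complex
  comm : φ.f 0 ≫ powAug J t = powAug J t' ≫ powProj J le

variable {J}

/-- The lift of the identity. -/
noncomputable def PowLift.id (t : ℕ) : PowLift J t t where
  le := le_rfl
  φ := 𝟙 _
  comm := by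
    have : powProj J (le_refl t) = 𝟙 _ := by
      ext; rfl
    rw [this]; exact (Category.id_comp _).trans (Category.comp_id _).symm

/-- Composition of lifts. -/
noncomputable def PowLift.comp {t t' t'' : ℕ} (a : PowLift J t t') (b : PowLift J t' t'') :
    PowLift J t t'' where
  le := a.le.trans b.le
  φ := b.φ ≫ a.φ
  comm := by
    have : powProj J (a.le.trans b.le) = powProj J b.le ≫ powProj J a.le := by
      ext; rfl
    rw [this, HomologicalComplex.comp_f, Category.assoc, a.comm, ← Category.assoc, b.comm,
      Category.assoc]

/-- The canonical lift. -/
noncomputable def PowLift.lift {t t' : ℕ} (h : t ≤ t') : PowLift J t t' where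
  le := h
  φ := ProjectiveResolution.lift (powProj J h) _ _
  comm := ProjectiveResolution.lift_commutes_zero _ _ _

variable (J)

/-- Elementwise vanishing of the local cohomology of `M` in degree `i`. -/
def LCVanish (i : ℕ) (M : ModuleCat.{0} R) : Prop :=
  ∀ (t : ℕ) (f : (powRes J t).complex.X i ⟶ M), (powRes J t).complex.d (i + 1) i ≫ f = 0 →
    ∃ (t' : ℕ) (a : PowLift J t t') (g : (powRes J t').complex.X (i - 1) ⟶ M),
      (powRes J t').complex.d i (i - 1) ≫ g = a.φ.f i ≫ f

lemma lcVanish_iff (i : ℕ) (M : ModuleCat.{0} R) :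
    LCVanish J i M ↔ Subsingleton ((localCohomology J i).obj M) := by
  let D := localCohomology.diagram (localCohomology.idealPowersDiagram J) i
  let e := colimitObjIsoColimitCompEvaluation D M
  have h1 : Subsingleton ((localCohomology J i).obj M) ↔
      Subsingleton (colimit (D ⋙ (evaluation _ _).obj M) : ModuleCat R) :=
    e.toLinearEquiv.toEquiv.subsingleton_congr
  rw [h1]
  constructor
  · intro h
    refine subsingleton_of_forall_eq 0 fun y => ?_
    obtain ⟨j, x, rfl⟩ := Concrete.colimit_exists_rep _ y
    obtain ⟨f, hf, hx⟩ := exists_represents (powRes J j.unop.unop) i M x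
    obtain ⟨t', a, g, hg⟩ := h _ f hf
    have h2 := ((hx.map (powRes J t') (powProj J a.le) a.φ a.comm).eq_zero_iff).2 ⟨g, hg⟩
    let w : j ⟶ Opposite.op (Opposite.op t') :=
      Quiver.Hom.op (Quiver.Hom.op (homOfLE a.le))
    rw [← colimit.w (D ⋙ (evaluation _ _).obj M) w, ModuleCat.comp_apply]
    have h3 : ((D ⋙ (evaluation _ _).obj M).map w) x = 0 := h2
    rw [h3, map_zero]
  · intro h t f hf
    obtain ⟨x, hx⟩ := represents_of_cocycle (powRes J t) i M f hf
    let x' : (D ⋙ (evaluation _ _).obj M).obj (Opposite.op (Opposite.op t)) := x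
    obtain ⟨j', w, hw⟩ := Concrete.colimit_rep_eq_zero.{0, 0, 0, 0} R (D ⋙ (evaluation _ _).obj M) _ x'
      (Subsingleton.elim _ _)
    have le : t ≤ j'.unop.unop := leOfHom w.unop.unop
    let a := PowLift.lift (J := J) le
    obtain ⟨g, hg⟩ := ((hx.map (powRes J j'.unop.unop) (powProj J a.le) a.φ a.comm).eq_zero_iff).1 hw
    exact ⟨_, a, g, hg⟩

end

section
variable {R : Type} [CommRing R] (J : Ideal R)

lemma exists_lift_of_surjective {P M N : ModuleCat.{0} R} [Projective P] (g : M ⟶ N)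
    (hg : Function.Surjective g) (h : P ⟶ N) : ∃ h' : P ⟶ M, h' ≫ g = h := by
  have : Epi g := (ModuleCat.epi_iff_surjective g).2 hg
  exact ⟨Projective.factorThru h g, Projective.factorThru_comp h g⟩

lemma comp_eq_zero_of_exact {M' M M'' : ModuleCat.{0} R} {f : M' ⟶ M} {g : M ⟶ M''}
    (hfg : Function.Exact f g) : f ≫ g = 0 := by
  ext x; exact hfg.apply_apply_eq_zero x

lemma exists_lift_of_exact {P M' M M'' : ModuleCat.{0} R} [Projective P] {f : M' ⟶ M}
    {g : M ⟶ M''} (hfg : Function.Exact f g) (h : P ⟶ M) (hh : h ≫ g = 0) :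
    ∃ h' : P ⟶ M', h' ≫ f = h := by
  have e : (ShortComplex.mk f g (comp_eq_zero_of_exact hfg)).Exact := by
    rw [ShortComplex.moduleCat_exact_iff]
    exact fun x hx => (hfg x).1 hx
  exact ⟨e.liftFromProjective h hh, e.liftFromProjective_comp h hh⟩

variable {J} {M' M M'' : ModuleCat.{0} R} {f : M' ⟶ M} {g : M ⟶ M''}

instance (t i : ℕ) : Projective ((powRes J t).complex.X i) := (powRes J t).projective i


lemma PowLift.comp_f {t t' t'' : ℕ} (a : PowLift J t t') (b : PowLift J t' t'') (i : ℕ) :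
    (a.comp b).φ.f i = b.φ.f i ≫ a.φ.f i := rfl

lemma LCVanish.extension {i : ℕ} (hf : Function.Injective f) (hg : Function.Surjective g)
    (hfg : Function.Exact f g) (h' : LCVanish J i M') (h'' : LCVanish J i M'') :
    LCVanish J i M := by
  have : Mono f := (ModuleCat.mono_iff_injective f).2 hf
  intro t c hc
  obtain ⟨t', a, γ, hγ⟩ := h'' t (c ≫ g) (by rw [reassoc_of% hc, zero_comp])
  obtain ⟨γ', rfl⟩ := exists_lift_of_surjective g hg γ
  obtain ⟨c', hc'⟩ := exists_lift_of_exact hfg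
    (a.φ.f i ≫ c - (powRes J t').complex.d i (i - 1) ≫ γ') (by
      simp only [Preadditive.sub_comp, Category.assoc, hγ, sub_self])
  obtain ⟨t'', b, δ, hδ⟩ := h' t' c' (by
    rw [← cancel_mono f, Category.assoc, hc', Preadditive.comp_sub, ← a.φ.comm_assoc, hc]
    simp)
  refine ⟨t'', a.comp b, δ ≫ f + b.φ.f (i - 1) ≫ γ', ?_⟩
  have : a.φ.f i ≫ c = c' ≫ f + (powRes J t').complex.d i (i - 1) ≫ γ' := by rw [hc']; abel
  rw [PowLift.comp_f, Category.assoc, this, Preadditive.comp_add, Preadditive.comp_add,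
    b.φ.comm_assoc, reassoc_of% hδ]

lemma LCVanish.quotient {i : ℕ} (hf : Function.Injective f) (hg : Function.Surjective g)
    (hfg : Function.Exact f g) (h' : LCVanish J (i + 1) M') (h : LCVanish J i M) :
    LCVanish J i M'' := by
  have : Mono f := (ModuleCat.mono_iff_injective f).2 hf
  intro t c hc
  obtain ⟨c, rfl⟩ := exists_lift_of_surjective g hg c
  obtain ⟨c', hc'⟩ := exists_lift_of_exact hfg ((powRes J t).complex.d (i + 1) i ≫ c) (by
      simpa using hc)
  obtain ⟨t', a, γ, hγ⟩ := h' t c' (by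
    rw [← cancel_mono f, Category.assoc, hc']; simp)
  change (powRes J t').complex.X i ⟶ M' at γ
  change (powRes J t').complex.d (i + 1) i ≫ γ = _ at hγ
  obtain ⟨t'', b, δ, hδ⟩ := h t' (a.φ.f i ≫ c - γ ≫ f) (by
    rw [Preadditive.comp_sub, ← a.φ.comm_assoc, reassoc_of% hγ, hc']; simp)
  refine ⟨t'', a.comp b, δ ≫ g, ?_⟩
  rw [PowLift.comp_f, reassoc_of% hδ, Preadditive.sub_comp]
  simp [comp_eq_zero_of_exact hfg]

lemma smul_eq_zero_of_pow {x : R} (hx : x ∈ J) (t : ℕ) :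
    x ^ t • 𝟙 (ModuleCat.of R (R ⧸ J ^ t)) = 0 := by
  ext
  change x ^ t • (Submodule.Quotient.mk 1 : R ⧸ J ^ t) = 0
  rw [← Submodule.Quotient.mk_smul, Submodule.Quotient.mk_eq_zero]
  simpa using Ideal.pow_mem_pow hx t

lemma powRes_homotopy {x : R} (hx : x ∈ J) (t : ℕ) :
    Nonempty (Homotopy (x ^ t • 𝟙 (powRes J t).complex) 0) := by
  refine ⟨ProjectiveResolution.liftHomotopyZero _ ?_⟩
  refine HomologicalComplex.to_single_hom_ext ?_
  change (x ^ t • 𝟙 ((powRes J t).complex.X 0)) ≫ powAug J t = 0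
  rw [Linear.smul_comp, Category.id_comp]
  have : x ^ t • powAug J t = powAug J t ≫ (x ^ t • 𝟙 (ModuleCat.of R (R ⧸ J ^ t))) := by
    rw [Linear.comp_smul, Category.comp_id]
  rw [this, smul_eq_zero_of_pow hx, comp_zero]

lemma pow_smul_coboundary {x : R} (hx : x ∈ J) {t i : ℕ}
    (c : (powRes J t).complex.X (i + 1) ⟶ M) (hc : (powRes J t).complex.d (i + 2) (i + 1) ≫ c = 0) :
    ∃ γ : (powRes J t).complex.X i ⟶ M, (powRes J t).complex.d (i + 1) i ≫ γ = x ^ t • c := by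
  obtain ⟨h⟩ := powRes_homotopy hx t
  refine ⟨h.hom i (i + 1) ≫ c, ?_⟩
  have := h.comm (i + 1)
  rw [Homotopy.prevD_chainComplex, Homotopy.dNext_succ_chainComplex] at this
  have := congrArg (· ≫ c) this
  simpa [hc] using this.symm

lemma pow_smul_eq_zero {x : R} (hx : x ∈ J) {t : ℕ}
    (c : (powRes J t).complex.X 0 ⟶ M) (hc : (powRes J t).complex.d 1 0 ≫ c = 0) :
    x ^ t • c = 0 := by
  obtain ⟨h⟩ := powRes_homotopy hx t
  have := h.comm 0
  rw [Homotopy.prevD_chainComplex, Homotopy.dNext_zero_chainComplex] at this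
  have := congrArg (· ≫ c) this
  simpa [hc] using this

lemma LCVanish.zero_of_regular {x : R} (hx : x ∈ J) (hreg : IsSMulRegular M x) :
    LCVanish J 0 M := by
  intro t c hc
  refine ⟨t, PowLift.id t, 0, ?_⟩
  have h0 := pow_smul_eq_zero hx c hc
  have : c = 0 := by
    ext y
    apply hreg.pow t
    have h1 : (x ^ t • c).hom y = 0 := by rw [h0]; rfl
    exact h1.trans (smul_zero _).symm
  simp [this]

lemma LCVanish.succ_of_regular {x : R} (hx : x ∈ J) {i : ℕ} {g : M ⟶ M''}
    (hreg : IsSMulRegular M x) (hg : Function.Surjective g)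
    (hxg : Function.Exact (x • 𝟙 M : M ⟶ M) g) (h : LCVanish J i M'') :
    LCVanish J (i + 1) M := by
  have hxg0 : x • g = 0 := by simpa using comp_eq_zero_of_exact hxg
  have : Mono (x • 𝟙 M : M ⟶ M) := (ModuleCat.mono_iff_injective _).2 fun a b hab => hreg hab
  have key : ∀ (s t : ℕ) (c : (powRes J t).complex.X (i + 1) ⟶ M),
      (∃ γ : (powRes J t).complex.X i ⟶ M, (powRes J t).complex.d (i + 1) i ≫ γ = x ^ s • c) →
      ∃ (t' : ℕ) (a : PowLift J t t') (γ : (powRes J t').complex.X i ⟶ M),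
        (powRes J t').complex.d (i + 1) i ≫ γ = a.φ.f (i + 1) ≫ c := by
    intro s
    induction s with
    | zero =>
      rintro t c ⟨γ, hγ⟩
      exact ⟨t, PowLift.id t, γ, by rw [hγ]; simp [PowLift.id]⟩
    | succ s ih =>
      rintro t c ⟨γ, hγ⟩
      obtain ⟨t', a, δ, hδ⟩ := h t (γ ≫ g) (by
        rw [reassoc_of% hγ, pow_succ, mul_smul, Linear.smul_comp, Linear.smul_comp,
          ← Linear.comp_smul, hxg0, comp_zero, smul_zero])
      obtain ⟨δ, rfl⟩ := exists_lift_of_surjective g hg δ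
      obtain ⟨ε, hε⟩ := exists_lift_of_exact hxg
        (a.φ.f i ≫ γ - (powRes J t').complex.d i (i - 1) ≫ δ) (by
          simp only [Preadditive.sub_comp, Category.assoc, hδ, sub_self])
      obtain ⟨t'', b, η, hη⟩ := ih t' (a.φ.f (i + 1) ≫ c) ⟨ε, by
        rw [← cancel_mono (x • 𝟙 M : M ⟶ M), Category.assoc, hε, Preadditive.comp_sub,
          ← a.φ.comm_assoc, hγ, Linear.comp_smul, Linear.comp_smul,
          Category.comp_id, HomologicalComplex.d_comp_d_assoc, zero_comp, sub_zero, pow_succ',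
          mul_smul]⟩
      exact ⟨t'', a.comp b, η, by rw [hη, PowLift.comp_f, Category.assoc]⟩
  intro t c hc
  exact key t t c (pow_smul_coboundary hx c hc)

lemma LCVanish.eq_zero_of_smul (h : LCVanish J 0 M) (m : M) (hm : ∀ x ∈ J, x • m = 0) :
    m = 0 := by
  let φ : ModuleCat.of R (R ⧸ J ^ 1) ⟶ M := ModuleCat.ofHom
    (Submodule.liftQ _ (LinearMap.toSpanSingleton R M m) (by
      intro x hx
      rw [pow_one] at hx
      exact hm x hx))
  obtain ⟨t', a, γ, hγ⟩ := h 1 (powAug J 1 ≫ φ) (by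
    have : (powRes J 1).complex.d 1 0 ≫ powAug J 1 = 0 := (powRes J 1).complex_d_comp_π_f_zero
    rw [reassoc_of% this, zero_comp])
  have e1 : Epi (powAug J t') := inferInstanceAs (Epi ((powRes J t').π.f 0))
  have h0 : powAug J t' ≫ powProj J a.le ≫ φ = 0 := by
    rw [← Category.assoc, ← a.comm, Category.assoc, ← hγ]; simp
  have h1 : powProj J a.le ≫ φ = 0 := by
    rw [← cancel_epi (powAug J t'), h0, comp_zero]
  have h2 : (powProj J a.le ≫ φ).hom (Submodule.Quotient.mk 1) = m := one_smul R m
  rw [← h2, h1]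
  rfl

lemma LCVanish.exists_regular [IsNoetherianRing R] [Module.Finite R M] (h : LCVanish J 0 M) :
    ∃ x ∈ J, IsSMulRegular M x := by
  have : Subsingleton ((R ⧸ J) →ₗ[R] M) := by
    refine subsingleton_of_forall_eq 0 fun φ => ?_
    ext
    refine h.eq_zero_of_smul _ fun x hx => ?_
    rw [← map_smul]
    have : x • (Submodule.Quotient.mk 1 : R ⧸ J) = 0 := by
      rw [← Submodule.Quotient.mk_smul, Submodule.Quotient.mk_eq_zero]
      simpa using hx
    exact (congrArg φ this).trans (map_zero φ)
  obtain ⟨x, hx, hr⟩ := IsSMulRegular.subsingleton_linearMap_iff.1 this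
  rw [Ideal.annihilator_quotient] at hx
  exact ⟨x, hx, hr⟩
end

end PaperHTT
end

section
open CategoryTheory Limits Pointwise

namespace PaperHTT

section
variable {R : Type} [CommRing R] (J : Ideal R)

/-- `M` has a weakly regular sequence of length `n` consisting of elements of `J`. -/
def HasRegSeq : ℕ → ∀ (M : Type) [AddCommGroup M] [Module R M], Prop
  | 0, _, _, _ => True
  | n + 1, M, _, _ => ∃ x ∈ J, IsSMulRegular M x ∧ HasRegSeq n (QuotSMulTop x M)

variable {J} {M M' M'' : Type} [AddCommGroup M] [Module R M] [AddCommGroup M'] [Module R M']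
  [AddCommGroup M''] [Module R M'']

lemma HasRegSeq.congr {n : ℕ} : ∀ {M M' : Type} [AddCommGroup M] [Module R M] [AddCommGroup M']
    [Module R M'] (_ : M ≃ₗ[R] M') (_ : HasRegSeq J n M), HasRegSeq J n M' := by
  induction n with
  | zero => intros; trivial
  | succ n ih =>
    rintro M M' _ _ _ _ e ⟨x, hx, hr, h⟩
    exact ⟨x, hx, (e.isSMulRegular_congr x).1 hr, ih (QuotSMulTop.congr x e) h⟩

lemma exact_smul_mkQ (x : R) : Function.Exact
    ((x • 𝟙 (ModuleCat.of R M) : ModuleCat.of R M ⟶ ModuleCat.of R M))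
    (ModuleCat.ofHom (x • (⊤ : Submodule R M)).mkQ) := by
  intro y
  change Submodule.Quotient.mk y = 0 ↔ _
  rw [Submodule.Quotient.mk_eq_zero, Submodule.mem_smul_pointwise_iff_exists]
  exact ⟨fun ⟨z, _, hz⟩ => ⟨z, hz⟩, fun ⟨z, hz⟩ => ⟨z, trivial, hz⟩⟩

lemma HasRegSeq.lcVanish {n : ℕ} : ∀ {M : Type} [AddCommGroup M] [Module R M]
    (_ : HasRegSeq J n M) (i : ℕ), i < n → LCVanish J i (ModuleCat.of R M) := by
  induction n with
  | zero => intros; omega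
  | succ n ih =>
    rintro M _ _ ⟨x, hx, hr, h⟩ i hi
    cases i with
    | zero => exact LCVanish.zero_of_regular hx hr
    | succ i =>
      exact LCVanish.succ_of_regular hx (g := ModuleCat.ofHom (x • (⊤ : Submodule R M)).mkQ) hr
        (Submodule.mkQ_surjective _) (exact_smul_mkQ x) (ih h i (by omega))

lemma LCVanish.quotSMulTop {i : ℕ} {x : R} (hr : IsSMulRegular M x)
    (h : LCVanish J i (ModuleCat.of R M)) (h' : LCVanish J (i + 1) (ModuleCat.of R M)) :
    LCVanish J i (ModuleCat.of R (QuotSMulTop x M)) :=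
  LCVanish.quotient (f := x • 𝟙 (ModuleCat.of R M))
    (g := ModuleCat.ofHom (x • (⊤ : Submodule R M)).mkQ) (fun _ _ h => hr h)
    (Submodule.mkQ_surjective _) (exact_smul_mkQ x) h' h

lemma hasRegSeq_of_lcVanish [IsNoetherianRing R] {n : ℕ} : ∀ {M : Type} [AddCommGroup M]
    [Module R M] [Module.Finite R M] (_ : ∀ i < n, LCVanish J i (ModuleCat.of R M)),
    HasRegSeq J n M := by
  induction n with
  | zero => intros; trivial
  | succ n ih =>
    intro M _ _ _ h
    have : Module.Finite R (ModuleCat.of R M) := ‹Module.Finite R M›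
    obtain ⟨x, hx, hr⟩ := (h 0 (by omega)).exists_regular
    have hr : IsSMulRegular M x := hr
    exact ⟨x, hx, hr, ih fun i hi => (h i (by omega)).quotSMulTop hr (h (i + 1) (by omega))⟩

lemma exists_not_lcVanish [IsNoetherianRing R] (hJ : J ≠ ⊤) (Q : Ideal R) (hQ : Q ≤ J) :
    ∃ i, ¬ LCVanish J i (ModuleCat.of R (R ⧸ Q)) := by
  induction Q using IsNoetherian.induction with
  | hgt Q ih =>
    by_contra! hv
    have : Module.Finite R (ModuleCat.of R (R ⧸ Q)) := inferInstanceAs (Module.Finite R (R ⧸ Q))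
    obtain ⟨x, hx, hr⟩ := (hv 0).exists_regular
    have hr : IsSMulRegular (R ⧸ Q) x := hr
    have hxQ : x ∉ Q := by
      intro h
      refine hJ (top_le_iff.1 (le_trans ?_ hQ))
      rw [top_le_iff, Ideal.eq_top_iff_one, ← Ideal.Quotient.eq_zero_iff_mem]
      refine hr ?_
      change x • Ideal.Quotient.mk Q 1 = x • 0
      rw [smul_zero, ← Ideal.Quotient.mk_eq_mk, ← Submodule.Quotient.mk_smul,
        Submodule.Quotient.mk_eq_zero]
      simpa using h
    obtain ⟨i, hi⟩ := ih (Q ⊔ Ideal.span {x})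
      (lt_of_le_of_ne le_sup_left fun h => hxQ (h ▸ (Ideal.mem_sup_right (Ideal.mem_span_singleton_self x))))
      (sup_le hQ (by simpa [Ideal.span_le] using hx))
    have le : Q ≤ Q ⊔ Ideal.span {x} := le_sup_left
    apply hi
    refine LCVanish.quotient (f := x • 𝟙 (ModuleCat.of R (R ⧸ Q)))
      (g := ModuleCat.ofHom (Submodule.factor le))
      (fun _ _ h => hr h) (Submodule.factor_surjective le) ?_ (hv _) (hv _)
    intro y
    obtain ⟨y, rfl⟩ := Ideal.Quotient.mk_surjective y
    change (Ideal.Quotient.mk (Q ⊔ Ideal.span {x}) y) = 0 ↔ _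
    rw [Ideal.Quotient.eq_zero_iff_mem, Submodule.mem_sup]
    constructor
    · rintro ⟨q, hq, z, hz, rfl⟩
      obtain ⟨w, rfl⟩ := Ideal.mem_span_singleton'.1 hz
      refine ⟨Ideal.Quotient.mk Q w, ?_⟩
      change Ideal.Quotient.mk Q (x * w) = _
      rw [Ideal.Quotient.mk_eq_mk_iff_sub_mem]
      simpa [mul_comm] using hq
    · rintro ⟨w, hw⟩
      obtain ⟨w, rfl⟩ := Ideal.Quotient.mk_surjective w
      change Ideal.Quotient.mk Q (x * w) = _ at hw
      rw [Ideal.Quotient.mk_eq_mk_iff_sub_mem] at hw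
      exact ⟨_, Q.neg_mem hw, x * w, Ideal.mem_span_singleton.2 (dvd_mul_right _ _), by ring⟩
end

end PaperHTT
end

section
open CategoryTheory Limits Pointwise TensorProduct

namespace PaperHTT

section
variable {R : Type} [CommRing R] {J : Ideal R} {M M'' : Type} [AddCommGroup M] [Module R M]
  [AddCommGroup M''] [Module R M'']

lemma HasRegSeq.succ_of_exact {n : ℕ} {x : R} (hx : x ∈ J) (hr : IsSMulRegular M x)
    (g : M →ₗ[R] M'') (hg : Function.Surjective g)
    (hxg : Function.Exact (fun m : M => x • m) g) (h : HasRegSeq J n M'') :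
    HasRegSeq J (n + 1) M := by
  have hk : x • (⊤ : Submodule R M) = LinearMap.ker g := by
    ext y
    rw [LinearMap.mem_ker, hxg y, Submodule.mem_smul_pointwise_iff_exists]
    exact ⟨fun ⟨z, _, hz⟩ => ⟨z, hz⟩, fun ⟨z, hz⟩ => ⟨z, trivial, hz⟩⟩
  exact ⟨x, hx, hr, h.congr ((Submodule.quotEquivOfEq _ _ hk).trans
    (g.quotKerEquivOfSurjective hg)).symm⟩

end

section
variable {k : Type} [Field k] {σ τ : Type}

lemma map_smul_of_split {T T' : Type} [AddCommGroup T] [AddCommGroup T']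
    [Module (MvPolynomial (σ ⊕ τ) k) T] [Module (MvPolynomial (σ ⊕ τ) k) T'] (f : T →+ T')
    (h1 : ∀ (p : MvPolynomial σ k) (t : T), f (rename (Sum.inl : σ → σ ⊕ τ) p • t) = rename (Sum.inl : σ → σ ⊕ τ) p • f t)
    (h2 : ∀ (p : MvPolynomial τ k) (t : T), f (rename (Sum.inr : τ → σ ⊕ τ) p • t) = rename (Sum.inr : τ → σ ⊕ τ) p • f t)
    (p : MvPolynomial (σ ⊕ τ) k) : ∀ t : T, f (p • t) = p • f t := by
  induction p using MvPolynomial.induction_on with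
  | C a => intro t; simpa using h1 (C a) t
  | add p q hp hq => intro t; rw [add_smul, add_smul, map_add, hp, hq]
  | mul_X p i hp =>
    intro t
    rw [mul_smul, mul_smul, hp]
    congr 1
    cases i with
    | inl i => simpa using h1 (X i) t
    | inr i => simpa using h2 (X i) t

variable (k σ τ) in
/-- The polynomial ring in two groups of variables is a tensor product. -/
noncomputable def splitEquiv :
    MvPolynomial (σ ⊕ τ) k ≃ₐ[k] MvPolynomial σ k ⊗[k] MvPolynomial τ k :=
  AlgEquiv.ofAlgHom
    (aeval (Sum.elim (fun i => X i ⊗ₜ[k] (1 : MvPolynomial τ k)) fun i => 1 ⊗ₜ X i))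
    (Algebra.TensorProduct.productMap (rename Sum.inl) (rename Sum.inr))
    (by ext <;> simp) (by ext i; cases i <;> simp)

lemma splitEquiv_inl (p : MvPolynomial σ k) :
    splitEquiv k σ τ (rename Sum.inl p) = p ⊗ₜ 1 := by
  rw [← AlgEquiv.eq_symm_apply]
  simp [splitEquiv]

lemma splitEquiv_inr (p : MvPolynomial τ k) :
    splitEquiv k σ τ (rename Sum.inr p) = 1 ⊗ₜ p := by
  rw [← AlgEquiv.eq_symm_apply]
  simp [splitEquiv]

section ext
variable (k σ τ) (M N : Type) [AddCommGroup M] [Module k M] [Module (MvPolynomial σ k) M]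
  [IsScalarTower k (MvPolynomial σ k) M] [AddCommGroup N] [Module k N]
  [Module (MvPolynomial τ k) N] [IsScalarTower k (MvPolynomial τ k) N]

/-- The action of the big polynomial ring on an external tensor product. -/
noncomputable def extAct : MvPolynomial (σ ⊕ τ) k →ₐ[k] Module.End k (M ⊗[k] N) :=
  (Module.endTensorEndAlgHom.comp
    (Algebra.TensorProduct.map (Algebra.lsmul k k M) (Algebra.lsmul k k N))).comp
    (splitEquiv k σ τ).toAlgHom

/-- The external tensor product of modules over two polynomial rings. -/
def ExtT (k σ τ M N : Type) [Field k] [AddCommGroup M] [Module k M] [Module (MvPolynomial σ k) M]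
    [IsScalarTower k (MvPolynomial σ k) M] [AddCommGroup N] [Module k N]
    [Module (MvPolynomial τ k) N] [IsScalarTower k (MvPolynomial τ k) N] : Type := M ⊗[k] N

noncomputable instance : AddCommGroup (ExtT k σ τ M N) := inferInstanceAs (AddCommGroup (M ⊗[k] N))

noncomputable instance : Module (MvPolynomial (σ ⊕ τ) k) (ExtT k σ τ M N) :=
  Module.compHom (M ⊗[k] N) (extAct k σ τ M N).toRingHom

variable {M N}

/-- Pure tensors. -/
def ExtT.tm (m : M) (n : N) : ExtT k σ τ M N := m ⊗ₜ[k] n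

lemma ExtT.smul_inl (p : MvPolynomial σ k) (t : ExtT k σ τ M N) :
    (rename Sum.inl p : MvPolynomial (σ ⊕ τ) k) • t =
      TensorProduct.map (Algebra.lsmul k k M p) (LinearMap.id (R := k) (M := N)) t := by
  change extAct k σ τ M N (rename Sum.inl p) t = _
  simp [extAct, splitEquiv_inl]
  rfl

lemma ExtT.smul_inr (p : MvPolynomial τ k) (t : ExtT k σ τ M N) :
    (rename Sum.inr p : MvPolynomial (σ ⊕ τ) k) • t =
      TensorProduct.map (LinearMap.id (R := k) (M := M)) (Algebra.lsmul k k N p) t := by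
  change extAct k σ τ M N (rename Sum.inr p) t = _
  simp [extAct, splitEquiv_inr]
  rfl

@[simp] lemma ExtT.smul_inl_tm (p : MvPolynomial σ k) (m : M) (n : N) :
    (rename Sum.inl p : MvPolynomial (σ ⊕ τ) k) • tm k σ τ m n = tm k σ τ (p • m) n := by
  rw [smul_inl]; rfl

@[simp] lemma ExtT.smul_inr_tm (p : MvPolynomial τ k) (m : M) (n : N) :
    (rename Sum.inr p : MvPolynomial (σ ⊕ τ) k) • tm k σ τ m n = tm k σ τ m (p • n) := by
  rw [smul_inr]; rfl

@[elab_as_elim]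
lemma ExtT.induction_on {C : ExtT k σ τ M N → Prop} (t : ExtT k σ τ M N) (zero : C 0)
    (tm : ∀ m n, C (tm k σ τ m n)) (add : ∀ x y, C x → C y → C (x + y)) : C t :=
  TensorProduct.induction_on t zero tm add

variable {M' N' : Type} [AddCommGroup M'] [Module k M'] [Module (MvPolynomial σ k) M']
  [IsScalarTower k (MvPolynomial σ k) M'] [AddCommGroup N'] [Module k N']
  [Module (MvPolynomial τ k) N'] [IsScalarTower k (MvPolynomial τ k) N']

/-- Functoriality of the external tensor product. -/
noncomputable def ExtT.map (f : M →ₗ[MvPolynomial σ k] M') (g : N →ₗ[MvPolynomial τ k] N') :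
    ExtT k σ τ M N →ₗ[MvPolynomial (σ ⊕ τ) k] ExtT k σ τ M' N' :=
  let F : ExtT k σ τ M N →+ ExtT k σ τ M' N' :=
    (TensorProduct.map (f.restrictScalars k) (g.restrictScalars k)).toAddMonoidHom
  { F with
    map_smul' := map_smul_of_split F
      (fun p t => by
        induction t using ExtT.induction_on with
        | zero => simp
        | add x y hx hy => rw [smul_add, map_add, map_add, hx, hy, smul_add]
        | tm m n =>
          rw [smul_inl_tm]
          change tm k σ τ (f (p • m)) (g n) = rename Sum.inl p • tm k σ τ (f m) (g n)
          rw [smul_inl_tm, map_smul])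
      (fun p t => by
        induction t using ExtT.induction_on with
        | zero => simp
        | add x y hx hy => rw [smul_add, map_add, map_add, hx, hy, smul_add]
        | tm m n =>
          rw [smul_inr_tm]
          change tm k σ τ (f m) (g (p • n)) = rename Sum.inr p • tm k σ τ (f m) (g n)
          rw [smul_inr_tm, map_smul]) }

@[simp] lemma ExtT.map_tm (f : M →ₗ[MvPolynomial σ k] M') (g : N →ₗ[MvPolynomial τ k] N')
    (m : M) (n : N) : ExtT.map k σ τ f g (tm k σ τ m n) = tm k σ τ (f m) (g n) := rfl

lemma ExtT.map_injective {f : M →ₗ[MvPolynomial σ k] M'} {g : N →ₗ[MvPolynomial τ k] N'}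
    (hf : Function.Injective f) (hg : Function.Injective g) :
    Function.Injective (ExtT.map k σ τ f g) := by
  have h1 := Module.Flat.lTensor_preserves_injective_linearMap (M := M') (g.restrictScalars k) hg
  have h2 := Module.Flat.rTensor_preserves_injective_linearMap (M := N) (f.restrictScalars k) hf
  have h3 : LinearMap.lTensor M' (g.restrictScalars k) ∘ₗ LinearMap.rTensor N (f.restrictScalars k)
      = TensorProduct.map (f.restrictScalars k) (g.restrictScalars k) :=
    LinearMap.lTensor_comp_rTensor _ _ _
  have h4 := h1.comp h2
  rw [← LinearMap.coe_comp, h3] at h4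
  exact h4

lemma ExtT.map_surjective {f : M →ₗ[MvPolynomial σ k] M'} {g : N →ₗ[MvPolynomial τ k] N'}
    (hf : Function.Surjective f) (hg : Function.Surjective g) :
    Function.Surjective (ExtT.map k σ τ f g) :=
  TensorProduct.map_surjective (g := f.restrictScalars k) (g' := g.restrictScalars k) hf hg

variable {M'' N'' : Type} [AddCommGroup M''] [Module k M''] [Module (MvPolynomial σ k) M'']
  [IsScalarTower k (MvPolynomial σ k) M''] [AddCommGroup N''] [Module k N'']
  [Module (MvPolynomial τ k) N''] [IsScalarTower k (MvPolynomial τ k) N'']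

lemma ExtT.map_exact_left {f : M →ₗ[MvPolynomial σ k] M'} {g : M' →ₗ[MvPolynomial σ k] M''}
    (hfg : Function.Exact f g) (hg : Function.Surjective g) :
    Function.Exact (ExtT.map k σ τ f (LinearMap.id (M := N))) (ExtT.map k σ τ g LinearMap.id) :=
  rTensor_exact (f := f.restrictScalars k) (g := g.restrictScalars k) N hfg hg

lemma ExtT.map_exact_right {f : N →ₗ[MvPolynomial τ k] N'} {g : N' →ₗ[MvPolynomial τ k] N''}
    (hfg : Function.Exact f g) (hg : Function.Surjective g) :
    Function.Exact (ExtT.map k σ τ (LinearMap.id (M := M)) f) (ExtT.map k σ τ LinearMap.id g) :=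
  lTensor_exact (f := f.restrictScalars k) (g := g.restrictScalars k) M hfg hg

end ext
end

section
variable {k : Type} [Field k] {σ τ : Type}

lemma ExtT.smul_inl_eq_map {M N : Type} [AddCommGroup M] [Module k M] [Module (MvPolynomial σ k) M]
    [IsScalarTower k (MvPolynomial σ k) M] [AddCommGroup N] [Module k N]
    [Module (MvPolynomial τ k) N] [IsScalarTower k (MvPolynomial τ k) N]
    (p : MvPolynomial σ k) (t : ExtT k σ τ M N) :
    (rename Sum.inl p : MvPolynomial (σ ⊕ τ) k) • t =
      ExtT.map k σ τ (LinearMap.lsmul _ M p) LinearMap.id t := smul_inl k σ τ p t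

lemma ExtT.smul_inr_eq_map {M N : Type} [AddCommGroup M] [Module k M] [Module (MvPolynomial σ k) M]
    [IsScalarTower k (MvPolynomial σ k) M] [AddCommGroup N] [Module k N]
    [Module (MvPolynomial τ k) N] [IsScalarTower k (MvPolynomial τ k) N]
    (p : MvPolynomial τ k) (t : ExtT k σ τ M N) :
    (rename Sum.inr p : MvPolynomial (σ ⊕ τ) k) • t =
      ExtT.map k σ τ LinearMap.id (LinearMap.lsmul _ N p) t := smul_inr k σ τ p t

lemma rename_mem_maxHomIdeal {σ' : Type} (f : σ → σ') {p : MvPolynomial σ k}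
    (hp : p ∈ maxHomIdeal k σ) : rename f p ∈ maxHomIdeal k σ' := by
  have : Ideal.map (rename f : MvPolynomial σ k →ₐ[k] MvPolynomial σ' k) (maxHomIdeal k σ) ≤
      maxHomIdeal k σ' := by
    rw [maxHomIdeal, Ideal.map_span, Ideal.span_le]
    rintro _ ⟨_, ⟨i, rfl⟩, rfl⟩
    exact Ideal.subset_span ⟨f i, by simp⟩
  exact this (Ideal.mem_map_of_mem _ hp)

lemma exact_smul_quotSMulTop {R M : Type} [CommRing R] [AddCommGroup M] [Module R M] (x : R) :
    Function.Exact (LinearMap.lsmul R M x) (x • (⊤ : Submodule R M)).mkQ := by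
  intro y
  rw [Submodule.mkQ_apply, Submodule.Quotient.mk_eq_zero, Submodule.mem_smul_pointwise_iff_exists]
  exact ⟨fun ⟨z, _, hz⟩ => ⟨z, hz⟩, fun ⟨z, hz⟩ => ⟨z, trivial, hz⟩⟩

lemma HasRegSeq.extT_right (q : ℕ) : ∀ {M N : Type} [AddCommGroup M] [Module k M]
    [Module (MvPolynomial σ k) M] [IsScalarTower k (MvPolynomial σ k) M] [AddCommGroup N]
    [Module k N] [Module (MvPolynomial τ k) N] [IsScalarTower k (MvPolynomial τ k) N]
    (_ : HasRegSeq (maxHomIdeal k τ) q N),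
    HasRegSeq (maxHomIdeal k (σ ⊕ τ)) q (ExtT k σ τ M N) := by
  induction q with
  | zero => intros; trivial
  | succ q ih =>
    rintro M N _ _ _ _ _ _ _ _ ⟨x, hx, hr, h⟩
    refine HasRegSeq.succ_of_exact (rename_mem_maxHomIdeal Sum.inr hx) ?_
      (ExtT.map k σ τ (LinearMap.id (M := M)) (x • (⊤ : Submodule (MvPolynomial τ k) N)).mkQ)
      (ExtT.map_surjective k σ τ Function.surjective_id (Submodule.mkQ_surjective _)) ?_ (ih h)
    · intro a b hab
      simp only [ExtT.smul_inr_eq_map] at hab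
      exact ExtT.map_injective k σ τ Function.injective_id (fun _ _ h => hr h) hab
    · simp only [ExtT.smul_inr_eq_map]
      exact ExtT.map_exact_right k σ τ (exact_smul_quotSMulTop x) (Submodule.mkQ_surjective _)

lemma HasRegSeq.extT (p q : ℕ) : ∀ {M N : Type} [AddCommGroup M] [Module k M]
    [Module (MvPolynomial σ k) M] [IsScalarTower k (MvPolynomial σ k) M] [AddCommGroup N]
    [Module k N] [Module (MvPolynomial τ k) N] [IsScalarTower k (MvPolynomial τ k) N]
    (_ : HasRegSeq (maxHomIdeal k σ) p M) (_ : HasRegSeq (maxHomIdeal k τ) q N),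
    HasRegSeq (maxHomIdeal k (σ ⊕ τ)) (p + q) (ExtT k σ τ M N) := by
  induction p with
  | zero => intro M N _ _ _ _ _ _ _ _ _ hN; rw [zero_add]; exact hN.extT_right
  | succ p ih =>
    rintro M N _ _ _ _ _ _ _ _ ⟨x, hx, hr, h⟩ hN
    rw [add_right_comm]
    refine HasRegSeq.succ_of_exact (rename_mem_maxHomIdeal Sum.inl hx) ?_
      (ExtT.map k σ τ (x • (⊤ : Submodule (MvPolynomial σ k) M)).mkQ (LinearMap.id (M := N)))
      (ExtT.map_surjective k σ τ (Submodule.mkQ_surjective _) Function.surjective_id) ?_ (ih h hN)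
    · intro a b hab
      simp only [ExtT.smul_inl_eq_map] at hab
      exact ExtT.map_injective k σ τ (fun _ _ h => hr h) Function.injective_id hab
    · simp only [ExtT.smul_inl_eq_map]
      exact ExtT.map_exact_left k σ τ (exact_smul_quotSMulTop x) (Submodule.mkQ_surjective _)


lemma lcVanish_of_lt_depthM {M : ModuleCat (MvPolynomial σ k)} {i : ℕ} (h : i < depthM k M) :
    LCVanish (maxHomIdeal k σ) i M := by
  rw [lcVanish_iff, ← not_nontrivial_iff_subsingleton]
  exact Nat.notMem_of_lt_sInf h

end

section
variable {k : Type} [Field k] {σ τ : Type}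

section
variable {p q : Ideal (MvPolynomial σ k)} {Y : Ideal (MvPolynomial τ k)}
  {P P' : Ideal (MvPolynomial (σ ⊕ τ) k)}

/-- Multiplication of representatives, from the product of `p/q` and `B/Y` to `R/P`. -/
noncomputable def extTBilin (hqP : ∀ f ∈ q, rename Sum.inl f ∈ P)
    (hpY : ∀ f ∈ p, ∀ g ∈ Y, rename Sum.inl f * rename Sum.inr g ∈ P) :
    subQuot k p q →ₛₗ[(rename Sum.inl : MvPolynomial σ k →ₐ[k] MvPolynomial (σ ⊕ τ) k).toRingHom]
      (MvPolynomial τ k ⧸ Y) →ₛₗ[(rename Sum.inr : MvPolynomial τ k →ₐ[k]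
        MvPolynomial (σ ⊕ τ) k).toRingHom] (MvPolynomial (σ ⊕ τ) k ⧸ P) :=
  Submodule.liftQ _
    { toFun := fun f => Submodule.liftQ _
        { toFun := fun g => Ideal.Quotient.mk P (rename Sum.inl (f : MvPolynomial σ k) * rename Sum.inr g)
          map_add' := fun x y => by simp [mul_add]
          map_smul' := fun c x => by
            change _ = Ideal.Quotient.mk P (rename Sum.inr c * _)
            rw [smul_eq_mul, map_mul (rename Sum.inr), mul_left_comm] }
        (fun g hg => by
          rw [LinearMap.mem_ker]
          exact Ideal.Quotient.eq_zero_iff_mem.mpr (hpY f f.2 g hg))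
      map_add' := fun x y => by
        refine Submodule.linearMap_qext _ (LinearMap.ext fun g => ?_)
        change Ideal.Quotient.mk P _ = Ideal.Quotient.mk P _ + Ideal.Quotient.mk P _
        rw [← map_add]
        simp [add_mul]
      map_smul' := fun c x => by
        refine Submodule.linearMap_qext _ (LinearMap.ext fun g => ?_)
        change Ideal.Quotient.mk P _ = Ideal.Quotient.mk P (rename Sum.inl c * _)
        simp [mul_assoc] }
    (fun f hf => by
      rw [LinearMap.mem_ker]
      refine Submodule.linearMap_qext _ (LinearMap.ext fun g => ?_)
      exact Ideal.Quotient.eq_zero_iff_mem.mpr (P.mul_mem_right _ (hqP f hf)))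

/-- The map from the external tensor product of `p/q` and `B/Y` to `R/P`. -/
noncomputable def extTToQuot (hqP : ∀ f ∈ q, rename Sum.inl f ∈ P)
    (hpY : ∀ f ∈ p, ∀ g ∈ Y, rename Sum.inl f * rename Sum.inr g ∈ P) :
    ExtT k σ τ (subQuot k p q) (MvPolynomial τ k ⧸ Y) →ₗ[MvPolynomial (σ ⊕ τ) k]
      (MvPolynomial (σ ⊕ τ) k ⧸ P) :=
  let b := extTBilin hqP hpY
  let F : ExtT k σ τ (subQuot k p q) (MvPolynomial τ k ⧸ Y) →+ (MvPolynomial (σ ⊕ τ) k ⧸ P) :=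
    TensorProduct.liftAddHom (LinearMap.toAddMonoidHom'.comp b.toAddMonoidHom) (fun c m n => by
      change b (c • m) n = b m (c • n)
      rw [← algebraMap_smul (MvPolynomial σ k) c m, ← algebraMap_smul (MvPolynomial τ k) c n,
        map_smulₛₗ, map_smulₛₗ, LinearMap.smul_apply]
      simp [algebraMap_eq])
  { F with
    map_smul' := map_smul_of_split F
      (fun p t => by
        induction t using ExtT.induction_on with
        | zero => simp
        | add x y hx hy => rw [smul_add, map_add, map_add, hx, hy, smul_add]
        | tm m n =>
          rw [ExtT.smul_inl_tm]
          change b (p • m) n = rename Sum.inl p • b m n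
          rw [map_smulₛₗ]; rfl)
      (fun p t => by
        induction t using ExtT.induction_on with
        | zero => simp
        | add x y hx hy => rw [smul_add, map_add, map_add, hx, hy, smul_add]
        | tm m n =>
          rw [ExtT.smul_inr_tm]
          change b m (p • n) = rename Sum.inr p • b m n
          rw [map_smulₛₗ]; rfl) }

lemma extTToQuot_tm (hqP : ∀ f ∈ q, rename Sum.inl f ∈ P)
    (hpY : ∀ f ∈ p, ∀ g ∈ Y, rename Sum.inl f * rename Sum.inr g ∈ P) (f : p)
    (g : MvPolynomial τ k) :
    extTToQuot hqP hpY (ExtT.tm k σ τ (Submodule.Quotient.mk f) (Ideal.Quotient.mk Y g)) =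
      Ideal.Quotient.mk P (rename Sum.inl (f : MvPolynomial σ k) * rename Sum.inr g) := rfl

lemma range_extTToQuot (hqP : ∀ f ∈ q, rename Sum.inl f ∈ P)
    (hpY : ∀ f ∈ p, ∀ g ∈ Y, rename Sum.inl f * rename Sum.inr g ∈ P) (h : P ≤ P')
    (hP' : P' = P ⊔ p.map (rename Sum.inl : MvPolynomial σ k →ₐ[k] MvPolynomial (σ ⊕ τ) k)) :
    Function.Exact (extTToQuot hqP hpY) (Submodule.factor h) := by
  intro y
  constructor
  · intro hy
    obtain ⟨y, rfl⟩ := Submodule.Quotient.mk_surjective _ y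
    have hy' : y ∈ P' := (Submodule.Quotient.mk_eq_zero _).mp hy
    rw [hP'] at hy'
    change y ∈ Submodule.comap P.mkQ (LinearMap.range (extTToQuot hqP hpY))
    refine (sup_le ?_ ?_ : P ⊔ _ ≤ _) hy'
    · intro z hz
      refine ⟨0, ?_⟩
      rw [map_zero, eq_comm]
      exact (Submodule.Quotient.mk_eq_zero _).mpr hz
    · rw [Ideal.map_le_iff_le_comap]
      intro f hf
      refine ⟨ExtT.tm k σ τ (Submodule.Quotient.mk ⟨f, hf⟩) (Ideal.Quotient.mk Y 1), ?_⟩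
      rw [extTToQuot_tm]
      simp only [map_one, mul_one]
      rfl
  · rintro ⟨t, rfl⟩
    induction t using ExtT.induction_on with
    | zero => simp
    | add x y hx hy => rw [map_add, map_add, hx, hy, add_zero]
    | tm m n =>
      obtain ⟨f, rfl⟩ := Submodule.Quotient.mk_surjective _ m
      obtain ⟨g, rfl⟩ := Ideal.Quotient.mk_surjective n
      rw [extTToQuot_tm]
      refine (Submodule.Quotient.mk_eq_zero _).mpr ?_
      rw [hP']
      exact Ideal.mul_mem_right _ _ (Ideal.mem_sup_right (Ideal.mem_map_of_mem _ f.2))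

lemma smul_mk_one {R : Type} [CommRing R] (Q : Ideal R) (f : R) :
    f • Ideal.Quotient.mk Q 1 = Ideal.Quotient.mk Q f := by
  rw [← Ideal.Quotient.mk_eq_mk, ← Submodule.Quotient.mk_smul, smul_eq_mul, mul_one]
  rfl

lemma extTToQuot_injective (hqP : ∀ f ∈ q, rename Sum.inl f ∈ P)
    (hpY : ∀ f ∈ p, ∀ g ∈ Y, rename Sum.inl f * rename Sum.inr g ∈ P)
    (hP : P ≤ q.map (rename Sum.inl : MvPolynomial σ k →ₐ[k] MvPolynomial (σ ⊕ τ) k) ⊔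
      Y.map (rename Sum.inr : MvPolynomial τ k →ₐ[k] MvPolynomial (σ ⊕ τ) k)) :
    Function.Injective (extTToQuot hqP hpY) := by
  let one : ExtT k σ τ (MvPolynomial σ k ⧸ q) (MvPolynomial τ k ⧸ Y) :=
    ExtT.tm k σ τ (Ideal.Quotient.mk q 1) (Ideal.Quotient.mk Y 1)
  let ψ : (MvPolynomial (σ ⊕ τ) k ⧸ P) →ₗ[MvPolynomial (σ ⊕ τ) k]
      ExtT k σ τ (MvPolynomial σ k ⧸ q) (MvPolynomial τ k ⧸ Y) :=
    Submodule.liftQ P (LinearMap.toSpanSingleton _ _ one) (by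
      refine hP.trans (sup_le ?_ ?_) <;> rw [Ideal.map_le_iff_le_comap] <;> intro f hf
      · change (rename Sum.inl f : MvPolynomial (σ ⊕ τ) k) • one = 0
        rw [ExtT.smul_inl_tm, smul_mk_one, Ideal.Quotient.eq_zero_iff_mem.mpr hf]
        exact TensorProduct.zero_tmul _ _
      · change (rename Sum.inr f : MvPolynomial (σ ⊕ τ) k) • one = 0
        rw [ExtT.smul_inr_tm, smul_mk_one, Ideal.Quotient.eq_zero_iff_mem.mpr hf]
        exact TensorProduct.tmul_zero _ _)
  have hψ : ∀ x, ψ (Ideal.Quotient.mk P x) = x • one := fun x => rfl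
  clear_value ψ
  let ι : subQuot k p q →ₗ[MvPolynomial σ k] (MvPolynomial σ k ⧸ q) :=
    Submodule.mapQ _ q p.subtype le_rfl
  have hι : Function.Injective ι := by
    rw [← LinearMap.ker_eq_bot, Submodule.ker_mapQ, Submodule.mkQ_map_self]
  have hcomp : ∀ t, ψ (extTToQuot hqP hpY t) = ExtT.map k σ τ ι LinearMap.id t := by
    intro t
    induction t using ExtT.induction_on with
    | zero => simp
    | add x y hx hy => simp only [map_add, hx, hy]
    | tm m n =>
      obtain ⟨f, rfl⟩ := Submodule.Quotient.mk_surjective _ m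
      obtain ⟨g, rfl⟩ := Ideal.Quotient.mk_surjective n
      rw [extTToQuot_tm, ExtT.map_tm]
      rw [hψ, mul_smul, ExtT.smul_inr_tm, ExtT.smul_inl_tm, smul_mk_one, smul_mk_one]
      rfl
  have hinj := ExtT.map_injective k σ τ hι (N := MvPolynomial τ k ⧸ Y) (g := LinearMap.id)
    Function.injective_id
  intro a b hab
  apply hinj
  rw [← hcomp, ← hcomp, hab]

end

lemma sup_pow_le_pow_succ_sup_pow {R : Type} [CommRing R] (X Y : Ideal R) (a m : ℕ) :
    (X ⊔ Y) ^ (a + m) ≤ X ^ (a + 1) ⊔ Y ^ m := by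
  rw [← Submodule.add_eq_sup, add_pow, Ideal.sum_eq_sup, Finset.sup_le_iff]
  intro i hi
  refine Ideal.mul_le_left.trans ?_
  by_cases h : a + 1 ≤ i
  · exact le_trans (Ideal.mul_le_left.trans (Ideal.pow_le_pow_right h)) le_sup_left
  · have h' : m ≤ a + m - i := by omega
    exact le_trans (Ideal.mul_le_right.trans (Ideal.pow_le_pow_right h')) le_sup_right

end

section
variable {R : Type} [CommRing R] {J : Ideal R} {M M' M'' : Type} [AddCommGroup M] [Module R M]
  [AddCommGroup M'] [Module R M'] [AddCommGroup M''] [Module R M'']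

lemma LCVanish.of_exact {i : ℕ} {f : M' →ₗ[R] M} {g : M →ₗ[R] M''} (hf : Function.Injective f)
    (hg : Function.Surjective g) (hfg : Function.Exact f g)
    (h' : LCVanish J i (ModuleCat.of R M')) (h'' : LCVanish J i (ModuleCat.of R M'')) :
    LCVanish J i (ModuleCat.of R M) :=
  LCVanish.extension (f := ModuleCat.ofHom f) (g := ModuleCat.ofHom g) hf hg hfg h' h''

lemma LCVanish.of_subsingleton (i : ℕ) [Subsingleton M] : LCVanish J i (ModuleCat.of R M) := by
  intro t f _
  refine ⟨t, PowLift.id t, 0, ?_⟩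
  ext x
  exact Subsingleton.elim (α := M) _ _

end

section
variable {k : Type} [Field k] {σ τ : Type}

section
variable {p q : Ideal (MvPolynomial σ k)}

/-- The inclusion of `p/q` into `A/q`. -/
noncomputable def subQuotIncl (p q : Ideal (MvPolynomial σ k)) :
    subQuot k p q →ₗ[MvPolynomial σ k] (MvPolynomial σ k ⧸ q) :=
  Submodule.mapQ _ q p.subtype le_rfl

lemma subQuotIncl_injective : Function.Injective (subQuotIncl p q) := by
  rw [← LinearMap.ker_eq_bot, subQuotIncl, Submodule.ker_mapQ, Submodule.mkQ_map_self]

lemma exact_subQuotIncl (h : q ≤ p) : Function.Exact (subQuotIncl p q) (Submodule.factor h) := by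
  intro y
  obtain ⟨y, rfl⟩ := Submodule.Quotient.mk_surjective _ y
  constructor
  · intro hy
    exact ⟨Submodule.Quotient.mk ⟨y, (Submodule.Quotient.mk_eq_zero _).mp hy⟩, rfl⟩
  · rintro ⟨t, ht⟩
    obtain ⟨f, rfl⟩ := Submodule.Quotient.mk_surjective _ t
    rw [← ht]
    exact (Submodule.Quotient.mk_eq_zero _).mpr f.2

end

lemma lcVanish_quot_pow {J' : Ideal (MvPolynomial σ k)} {J : Ideal (MvPolynomial σ k)} {i : ℕ}
    (m : ℕ) (h : ∀ j < m, LCVanish J' i (ModuleCat.of _ (subQuot k (J ^ j) (J ^ (j + 1))))) :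
    LCVanish J' i (ModuleCat.of _ (MvPolynomial σ k ⧸ J ^ m)) := by
  induction m with
  | zero =>
    have : Subsingleton (MvPolynomial σ k ⧸ J ^ 0) := by
      rw [Ideal.Quotient.subsingleton_iff, pow_zero, Ideal.one_eq_top]
    exact LCVanish.of_subsingleton i
  | succ m ih =>
    exact LCVanish.of_exact subQuotIncl_injective (Submodule.factor_surjective _)
      (exact_subQuotIncl (Ideal.pow_le_pow_right m.le_succ)) (h m m.lt_succ_self)
      (ih fun j hj => h j (hj.trans m.lt_succ_self))

section
variable (k σ τ) in
/-- The inclusion of the first polynomial ring. -/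
noncomputable abbrev inlHom : MvPolynomial σ k →ₐ[k] MvPolynomial (σ ⊕ τ) k := rename Sum.inl

variable (k σ τ) in
/-- The inclusion of the second polynomial ring. -/
noncomputable abbrev inrHom : MvPolynomial τ k →ₐ[k] MvPolynomial (σ ⊕ τ) k := rename Sum.inr

variable (I : Ideal (MvPolynomial σ k)) (J : Ideal (MvPolynomial τ k))

/-- The filtration of `R` by the ideals `(I + J)^n + I^a`. -/
noncomputable def powFil (n a : ℕ) : Ideal (MvPolynomial (σ ⊕ τ) k) :=
  (I.map (inlHom k σ τ) ⊔ J.map (inrHom k σ τ)) ^ n ⊔ (I ^ a).map (inlHom k σ τ)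

variable {n a : ℕ}

lemma powFil_succ_le : powFil I J n (a + 1) ≤ powFil I J n a :=
  sup_le_sup_left (Ideal.map_mono (Ideal.pow_le_pow_right a.le_succ)) _

lemma powFil_zero : powFil I J n 0 = ⊤ := by
  rw [powFil, pow_zero, Ideal.one_eq_top, Ideal.map_top, sup_top_eq]

lemma powFil_self :
    powFil I J n n = (I.map (inlHom k σ τ) ⊔ J.map (inrHom k σ τ)) ^ n := by
  rw [powFil, Ideal.map_pow, sup_eq_left]
  exact Ideal.pow_right_mono le_sup_left n

lemma powFil_eq_sup : powFil I J n a =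
    powFil I J n (a + 1) ⊔ (I ^ a).map (rename Sum.inl : _ →ₐ[k] MvPolynomial (σ ⊕ τ) k) := by
  apply le_antisymm
  · exact sup_le (le_sup_left.trans le_sup_left) le_sup_right
  · exact sup_le (powFil_succ_le I J) le_sup_right

lemma mem_powFil_left : ∀ f ∈ I ^ (a + 1),
    (rename Sum.inl f : MvPolynomial (σ ⊕ τ) k) ∈ powFil I J n (a + 1) :=
  fun _ hf => Ideal.mem_sup_right (Ideal.mem_map_of_mem _ hf)

lemma mul_mem_powFil {m : ℕ} (h : n = a + m) : ∀ f ∈ I ^ a, ∀ g ∈ J ^ m,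
    (rename Sum.inl f * rename Sum.inr g : MvPolynomial (σ ⊕ τ) k) ∈ powFil I J n (a + 1) := by
  intro f hf g hg
  refine Ideal.mem_sup_left ?_
  rw [h, pow_add]
  refine Ideal.mul_mem_mul (Ideal.pow_right_mono le_sup_left a ?_)
    (Ideal.pow_right_mono le_sup_right m ?_)
  · rw [← Ideal.map_pow]; exact Ideal.mem_map_of_mem _ hf
  · rw [← Ideal.map_pow]; exact Ideal.mem_map_of_mem _ hg

lemma powFil_le {m : ℕ} (h : n = a + m) : powFil I J n (a + 1) ≤
    (I ^ (a + 1)).map (rename Sum.inl : _ →ₐ[k] MvPolynomial (σ ⊕ τ) k) ⊔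
      (J ^ m).map (rename Sum.inr : _ →ₐ[k] MvPolynomial (σ ⊕ τ) k) := by
  refine sup_le ?_ le_sup_left
  rw [h, Ideal.map_pow, Ideal.map_pow]
  exact sup_pow_le_pow_succ_sup_pow _ _ _ _

/-- The inclusion of a graded piece of the filtration `powFil`. -/
noncomputable def powFilIncl {m : ℕ} (h : n = a + m) :
    ExtT k σ τ (subQuot k (I ^ a) (I ^ (a + 1))) (MvPolynomial τ k ⧸ J ^ m)
      →ₗ[MvPolynomial (σ ⊕ τ) k] (MvPolynomial (σ ⊕ τ) k ⧸ powFil I J n (a + 1)) :=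
  extTToQuot (mem_powFil_left I J) (mul_mem_powFil I J h)

lemma powFilIncl_injective {m : ℕ} (h : n = a + m) : Function.Injective (powFilIncl I J h) :=
  extTToQuot_injective _ _ (powFil_le I J h)

lemma exact_powFilIncl {m : ℕ} (h : n = a + m) :
    Function.Exact (powFilIncl I J h) (Submodule.factor (powFil_succ_le I J)) :=
  range_extTToQuot _ _ _ (powFil_eq_sup I J)

end

lemma le_maxHomIdeal {I : Ideal (MvPolynomial σ k)} (hI : I ≠ ⊤) (hh : IsHomogeneousIdeal k I) :
    I ≤ maxHomIdeal k σ := by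
  intro f hf
  have h0 : homogeneousComponent 0 f = 0 := by
    by_contra h
    apply hI
    have h1 := hh f hf 0
    rw [homogeneousComponent_zero] at h h1
    refine Ideal.eq_top_of_isUnit_mem _ h1 (IsUnit.map C ?_)
    exact isUnit_iff_ne_zero.mpr fun h2 => h (by rw [h2, map_zero])
  rw [homogeneousComponent_zero, MvPolynomial.C_eq_zero] at h0
  rw [maxHomIdeal, ← Set.image_univ, mem_ideal_span_X_image]
  intro m hm
  by_contra! h
  have : m = 0 := Finsupp.ext fun i => h i (Set.mem_univ i)
  rw [this, mem_support_iff] at hm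
  exact hm h0

lemma maxHomIdeal_ne_top : maxHomIdeal k σ ≠ ⊤ := by
  rw [Ne, Ideal.eq_top_iff_one, maxHomIdeal, ← Set.image_univ, mem_ideal_span_X_image]
  push Not
  exact ⟨0, by simp, by simp⟩

end

section
variable {k : Type} [Field k] {r s : ℕ}

lemma lcVanish_sumIJ_pow (I : Ideal (PA k r)) (J : Ideal (PB k s)) (n d : ℕ)
    (h : ∀ i j : ℕ, i + j + 1 ≤ n → d ≤
      depthSubQuot k (I ^ i) (I ^ (i + 1)) + depthSubQuot k (J ^ j) (J ^ (j + 1)))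
    (i : ℕ) (hi : i < d) :
    LCVanish (maxHomIdeal k (Fin r ⊕ Fin s)) i
      (ModuleCat.of _ (PR k r s ⧸ (sumIJ k I J) ^ n)) := by
  suffices ∀ a ≤ n, LCVanish (maxHomIdeal k (Fin r ⊕ Fin s)) i
      (ModuleCat.of _ (PR k r s ⧸ powFil I J n a)) by
    have h1 := this n le_rfl
    rwa [powFil_self] at h1
  intro a ha
  induction a with
  | zero =>
    have : Subsingleton (PR k r s ⧸ powFil I J n 0) := by
      rw [Ideal.Quotient.subsingleton_iff, powFil_zero]
    exact LCVanish.of_subsingleton i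
  | succ a ih =>
    obtain ⟨m, rfl⟩ : ∃ m, n = a + m := ⟨n - a, by omega⟩
    refine LCVanish.of_exact (powFilIncl_injective I J rfl) (Submodule.factor_surjective _)
      (exact_powFilIncl I J rfl) ?_ (ih (by omega))
    let p := depthSubQuot k (I ^ a) (I ^ (a + 1))
    have hA : HasRegSeq (maxHomIdeal k (Fin r)) p (subQuot k (I ^ a) (I ^ (a + 1))) :=
      hasRegSeq_of_lcVanish fun i hi => lcVanish_of_lt_depthM hi
    have hB : HasRegSeq (maxHomIdeal k (Fin s)) (d - p) (PB k s ⧸ J ^ m) := by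
      refine hasRegSeq_of_lcVanish fun i hi => lcVanish_quot_pow m fun j hj =>
        lcVanish_of_lt_depthM ?_
      have h1 := h a j (by omega)
      change i < depthSubQuot k (J ^ j) (J ^ (j + 1))
      omega
    exact (hA.extT p _ hB).lcVanish i (by omega)

lemma sumIJ_pow_le_maxHomIdeal {I : Ideal (PA k r)} {J : Ideal (PB k s)} (hI1 : I ≠ ⊤)
    (hIh : IsHomogeneousIdeal k I) (hJ1 : J ≠ ⊤) (hJh : IsHomogeneousIdeal k J) {n : ℕ}
    (hn : 1 ≤ n) : (sumIJ k I J) ^ n ≤ maxHomIdeal k (Fin r ⊕ Fin s) := by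
  refine (Ideal.pow_le_self (by omega)).trans (sup_le ?_ ?_)
  · exact Ideal.map_le_iff_le_comap.mpr fun f hf =>
      rename_mem_maxHomIdeal _ (le_maxHomIdeal hI1 hIh hf)
  · exact Ideal.map_le_iff_le_comap.mpr fun f hf =>
      rename_mem_maxHomIdeal _ (le_maxHomIdeal hJ1 hJh hf)

lemma depth_bound (I : Ideal (PA k r)) (J : Ideal (PB k s)) (hI1 : I ≠ ⊤)
    (hIh : IsHomogeneousIdeal k I) (hJ1 : J ≠ ⊤) (hJh : IsHomogeneousIdeal k J)
    (n : ℕ) (hn : 1 ≤ n) :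
    sInf {v : ℕ | ∃ i j : ℕ, i + j ≤ n - 1 ∧
        v = depthSubQuot k (I ^ i) (I ^ (i + 1)) + depthSubQuot k (J ^ j) (J ^ (j + 1))} ≤
      depthQuot k ((sumIJ k I J) ^ n) := by
  have hle := sumIJ_pow_le_maxHomIdeal hI1 hIh hJ1 hJh hn
  obtain ⟨i, hi⟩ := exists_not_lcVanish maxHomIdeal_ne_top _ hle
  have hne : {i : ℕ | Nontrivial ((localCohomology (maxHomIdeal k (Fin r ⊕ Fin s)) i).obj
      (ModuleCat.of _ (PR k r s ⧸ (sumIJ k I J) ^ n)))}.Nonempty := by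
    refine ⟨i, ?_⟩
    rwa [lcVanish_iff, not_subsingleton_iff_nontrivial] at hi
  have hmem := Nat.sInf_mem hne
  by_contra! hlt
  have := lcVanish_sumIJ_pow I J n _ (fun i j hij => (Nat.sInf_le ⟨i, j, by omega, rfl⟩ :
    sInf {v : ℕ | ∃ i j : ℕ, i + j ≤ n - 1 ∧ v = depthSubQuot k (I ^ i) (I ^ (i + 1)) +
      depthSubQuot k (J ^ j) (J ^ (j + 1))} ≤ _)) _ hlt
  rw [lcVanish_iff, ← not_nontrivial_iff_subsingleton] at this
  exact this hmem

end

end PaperHTT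
end

section
open TensorProduct

namespace PaperHTT

section
variable {k : Type} [Field k] {σ : Type}

section
variable {p q : MvPolynomial σ k} {a b : ℤ}

lemma homogZ_zero : homogZ k (0 : MvPolynomial σ k) a := Or.inl rfl

lemma homogZ.add (hp : homogZ k p a) (hq : homogZ k q a) : homogZ k (p + q) a := by
  rcases hp with rfl | ⟨ha, hp⟩
  · rwa [zero_add]
  rcases hq with rfl | ⟨_, hq⟩
  · rw [add_zero]; exact Or.inr ⟨ha, hp⟩
  · exact Or.inr ⟨ha, hp.add hq⟩

lemma homogZ.neg (hp : homogZ k p a) : homogZ k (-p) a := by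
  rcases hp with rfl | ⟨ha, hp⟩
  · rw [neg_zero]; exact homogZ_zero
  · exact Or.inr ⟨ha, (homogeneousSubmodule σ k _).neg_mem hp⟩

lemma homogZ.mul (hp : homogZ k p a) (hq : homogZ k q b) : homogZ k (p * q) (a + b) := by
  rcases hp with rfl | ⟨ha, hp⟩
  · rw [zero_mul]; exact homogZ_zero
  rcases hq with rfl | ⟨hb, hq⟩
  · rw [mul_zero]; exact homogZ_zero
  · refine Or.inr ⟨add_nonneg ha hb, ?_⟩
    rw [Int.toNat_add ha hb]
    exact hp.mul hq

lemma homogZ_of_isHomogeneous {d : ℕ} (hp : p.IsHomogeneous d) : homogZ k p d :=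
  Or.inr ⟨Int.natCast_nonneg d, by simpa⟩

lemma homogZ_one : homogZ k (1 : MvPolynomial σ k) 0 :=
  homogZ_of_isHomogeneous (isHomogeneous_one σ k)

lemma homogZ.rename {τ : Type} (f : σ → τ) (hp : homogZ k p a) :
    homogZ k (MvPolynomial.rename f p) a := by
  rcases hp with rfl | ⟨ha, hp⟩
  · rw [map_zero]; exact homogZ_zero
  · exact Or.inr ⟨ha, hp.rename_isHomogeneous⟩

variable (k σ) in
/-- The degree-`t` piece of a polynomial ring. -/
def polyGr (t : ℤ) : AddSubgroup (MvPolynomial σ k) where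
  carrier := {p | homogZ k p t}
  add_mem' := homogZ.add
  zero_mem' := homogZ_zero
  neg_mem' := homogZ.neg

variable (k σ) in
/-- The projection of a polynomial ring to its degree-`t` piece. -/
noncomputable def polyProj (t : ℤ) : MvPolynomial σ k →+ MvPolynomial σ k :=
  if 0 ≤ t then (homogeneousComponent t.toNat).toAddMonoidHom else 0

lemma polyProj_of_homogZ (hp : homogZ k p a) : polyProj k σ a p = p := by
  rcases hp with rfl | ⟨ha, hp⟩
  · rw [map_zero]
  · rw [polyProj, if_pos ha]
    exact homogeneousComponent_eq_self hp

lemma polyProj_of_homogZ_ne (hp : homogZ k p b) (hab : a ≠ b) : polyProj k σ a p = 0 := by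
  rcases hp with rfl | ⟨hb, hp⟩
  · rw [map_zero]
  · rw [polyProj]
    split_ifs with ha
    · change homogeneousComponent a.toNat p = 0
      rw [homogeneousComponent_of_mem hp, if_neg (by omega)]
    · rfl

end

section grading
variable {M : Type} [AddCommGroup M] [Module (MvPolynomial σ k) M] {gr : ℤ → AddSubgroup M}

lemma IsGrading.of_proj (π : ℤ → M →+ M) (h1 : ∀ t, ∀ m ∈ gr t, π t m = m)
    (h2 : ∀ s t, s ≠ t → ∀ m ∈ gr t, π s m = 0) (h3 : ∀ m, m ∈ ⨆ t, gr t)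
    (h4 : ∀ (p : MvPolynomial σ k) (d : ℕ) (t : ℤ) (m : M), p.IsHomogeneous d → m ∈ gr t →
      p • m ∈ gr (t + d)) : IsGrading k σ gr := by
  refine ⟨⟨?_, fun m => ?_⟩, h4⟩
  · rw [injective_iff_map_eq_zero]
    intro x hx
    have h : ∀ s, π s (DirectSum.coeAddMonoidHom gr x) = x s := by
      intro s
      clear hx
      induction x using DirectSum.induction_on with
      | zero => simp
      | of t y =>
        rw [DirectSum.coeAddMonoidHom_of]
        by_cases hst : s = t
        · subst hst
          rw [h1 s _ y.2, DirectSum.of_eq_same]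
        · rw [h2 s t hst _ y.2, DirectSum.of_eq_of_ne _ _ _ hst, ZeroMemClass.coe_zero]
      | add x y hx hy => rw [map_add, map_add, hx, hy]; rfl
    refine DFinsupp.ext fun s => Subtype.ext ?_
    rw [← h s, hx, map_zero]; rfl
  · induction h3 m using AddSubgroup.iSup_induction' with
    | hp t x hx => exact ⟨DirectSum.of (fun t => gr t) t ⟨x, hx⟩, by simp⟩
    | h1 => exact ⟨0, map_zero _⟩
    | hadd x y _ _ hx hy =>
      obtain ⟨a, rfl⟩ := hx
      obtain ⟨b, rfl⟩ := hy
      exact ⟨a + b, map_add _ _ _⟩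

variable (h : IsGrading k σ gr)
include h

/-- The decomposition of an element into homogeneous components. -/
noncomputable def IsGrading.dec : M →+ (ℤ →₀ M) :=
  (DirectSum.toAddMonoid fun t => (Finsupp.singleAddHom t).comp (gr t).subtype).comp
    (AddEquiv.ofBijective _ h.1).symm.toAddMonoidHom

lemma IsGrading.dec_of_mem {t : ℤ} {m : M} (hm : m ∈ gr t) : h.dec m = Finsupp.single t m := by
  have h1 : (AddEquiv.ofBijective (DirectSum.coeAddMonoidHom gr) h.1).symm m =
      DirectSum.of (fun t => gr t) t ⟨m, hm⟩ := by
    rw [AddEquiv.symm_apply_eq]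
    exact (DirectSum.coeAddMonoidHom_of gr t ⟨m, hm⟩).symm
  change DirectSum.toAddMonoid _ ((AddEquiv.ofBijective (DirectSum.coeAddMonoidHom gr) h.1).symm m)
    = _
  rw [h1, DirectSum.toAddMonoid_of]
  rfl

lemma IsGrading.mem_iSup (m : M) : m ∈ ⨆ t, gr t := by
  obtain ⟨x, rfl⟩ := h.1.2 m
  induction x using DirectSum.induction_on with
  | zero => rw [map_zero]; exact zero_mem _
  | of t y =>
    rw [DirectSum.coeAddMonoidHom_of]
    exact AddSubgroup.mem_iSup_of_mem t y.2
  | add x y hx hy => rw [map_add]; exact add_mem hx hy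

@[elab_as_elim]
lemma IsGrading.induction {C : M → Prop} (m : M) (homog : ∀ t, ∀ m ∈ gr t, C m)
    (add : ∀ x y, C x → C y → C (x + y)) : C m := by
  induction h.mem_iSup m using AddSubgroup.iSup_induction' with
  | hp t x hx => exact homog t x hx
  | h1 => exact homog 0 0 (zero_mem _)
  | hadd x y _ _ hx hy => exact add x y hx hy

lemma IsGrading.dec_mem (m : M) (t : ℤ) : h.dec m t ∈ gr t := by
  induction m using h.induction with
  | homog s m hm =>
    rw [h.dec_of_mem hm, Finsupp.single_apply]
    split_ifs with hst
    · rwa [← hst]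
    · exact zero_mem _
  | add x y hx hy => rw [map_add]; exact add_mem hx hy

lemma IsGrading.sum_dec (m : M) : (h.dec m).sum (fun _ x => x) = m := by
  induction m using h.induction with
  | homog s m hm => rw [h.dec_of_mem hm, Finsupp.sum_single_index rfl]
  | add x y hx hy => rw [map_add, Finsupp.sum_add_index' (fun _ => rfl) (fun _ _ _ => rfl), hx, hy]

lemma IsGrading.smul_mem {p : MvPolynomial σ k} {a t : ℤ} (hp : homogZ k p a) {m : M}
    (hm : m ∈ gr t) : p • m ∈ gr (t + a) := by
  rcases hp with rfl | ⟨ha, hp⟩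
  · rw [zero_smul]; exact zero_mem _
  · have := h.2 p _ t m hp hm
    rwa [Int.toNat_of_nonneg ha] at this

lemma IsGrading.hom_dec {σ' M' : Type} [AddCommGroup M'] [Module (MvPolynomial σ' k) M']
    {gr' : ℤ → AddSubgroup M'} (h' : IsGrading k σ' gr') (f : M →+ M')
    (hf : ∀ t, ∀ m ∈ gr t, f m ∈ gr' t) (m : M) (t : ℤ) : h'.dec (f m) t = f (h.dec m t) := by
  induction m using h.induction with
  | homog s m hm =>
    rw [h.dec_of_mem hm, h'.dec_of_mem (hf s m hm), Finsupp.single_apply, Finsupp.single_apply]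
    split_ifs <;> simp
  | add x y hx hy => simp [hx, hy]

/-- Graded surjections are surjective in each degree. -/
lemma IsGrading.surj_degreewise {σ' M' : Type} [AddCommGroup M'] [Module (MvPolynomial σ' k) M']
    {gr' : ℤ → AddSubgroup M'} (h' : IsGrading k σ' gr') (f : M →+ M')
    (hf : ∀ t, ∀ m ∈ gr t, f m ∈ gr' t) {t : ℤ} {m : M} (hm : f m ∈ gr' t) :
    ∃ m₁ ∈ gr t, f m₁ = f m := by
  refine ⟨h.dec m t, h.dec_mem m t, ?_⟩
  rw [← h.hom_dec h' f hf, h'.dec_of_mem hm, Finsupp.single_eq_same]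

/-- Graded injections reflect degrees. -/
lemma IsGrading.mem_of_injective {σ' M' : Type} [AddCommGroup M'] [Module (MvPolynomial σ' k) M']
    {gr' : ℤ → AddSubgroup M'} (h' : IsGrading k σ' gr') (f : M →+ M')
    (hf : ∀ t, ∀ m ∈ gr t, f m ∈ gr' t) (hinj : Function.Injective f) {t : ℤ} {m : M}
    (hm : f m ∈ gr' t) : m ∈ gr t := by
  obtain ⟨m₁, h₁, h₂⟩ := h.surj_degreewise h' f hf hm
  rwa [← hinj h₂]

/-- The grading induced on a submodule. -/
lemma IsGrading.submodule (K : Submodule (MvPolynomial σ k) M)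
    (hK : ∀ m ∈ K, ∀ t, h.dec m t ∈ K) :
    IsGrading k σ fun t => (gr t).comap K.subtype.toAddMonoidHom := by
  let π : ℤ → K →+ K := fun t =>
    { toFun := fun m => ⟨h.dec m t, hK m m.2 t⟩
      map_zero' := Subtype.ext (by simp)
      map_add' := fun x y => Subtype.ext (by simp) }
  refine IsGrading.of_proj π (fun t m hm => Subtype.ext ?_) (fun s t hst m hm => Subtype.ext ?_)
    (fun m => ?_) (fun p d t m hp hm => h.2 p d t m hp hm)
  · change h.dec (m : M) t = m
    rw [h.dec_of_mem (show (m : M) ∈ gr t from hm), Finsupp.single_eq_same]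
  · change h.dec (m : M) s = 0
    rw [h.dec_of_mem (show (m : M) ∈ gr t from hm), Finsupp.single_eq_of_ne hst]
  · have h1 : m = ∑ t ∈ (h.dec (m : M)).support, π t m := by
      apply Subtype.ext
      rw [AddSubmonoidClass.coe_finsetSum]
      exact (h.sum_dec m).symm
    rw [h1]
    exact sum_mem fun t _ => AddSubgroup.mem_iSup_of_mem t (h.dec_mem m t)

/-- The grading induced on the kernel of a graded map. -/
lemma IsGrading.ker {M' : Type} [AddCommGroup M'] [Module (MvPolynomial σ k) M']
    {gr' : ℤ → AddSubgroup M'} (h' : IsGrading k σ gr') (f : M →ₗ[MvPolynomial σ k] M')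
    (hf : ∀ t, ∀ m ∈ gr t, f m ∈ gr' t) :
    IsGrading k σ fun t => (gr t).comap (LinearMap.ker f).subtype.toAddMonoidHom :=
  h.submodule _ fun m hm t => by
    rw [LinearMap.mem_ker] at hm ⊢
    have := h.hom_dec h' f.toAddMonoidHom hf m t
    rw [show f.toAddMonoidHom m = 0 from hm, map_zero] at this
    exact this.symm

/-- The grading induced on a quotient module. -/
lemma IsGrading.quotient (K : Submodule (MvPolynomial σ k) M)
    (hK : ∀ m ∈ K, ∀ t, h.dec m t ∈ K) :
    IsGrading k σ fun t => (gr t).map K.mkQ.toAddMonoidHom := by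
  let π : ℤ → (M ⧸ K) →+ (M ⧸ K) := fun t =>
    QuotientAddGroup.map K.toAddSubgroup K.toAddSubgroup
      ((Finsupp.applyAddHom t).comp h.dec) fun m hm => hK m hm t
  have hπ : ∀ t m, π t (K.mkQ m) = K.mkQ (h.dec m t) := fun t m => rfl
  refine IsGrading.of_proj π ?_ ?_ ?_ ?_
  · rintro t _ ⟨m, hm, rfl⟩
    change π t (K.mkQ m) = K.mkQ m
    rw [hπ, h.dec_of_mem hm, Finsupp.single_eq_same]
  · rintro s t hst _ ⟨m, hm, rfl⟩
    change π s (K.mkQ m) = 0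
    rw [hπ, h.dec_of_mem hm, Finsupp.single_eq_of_ne hst, map_zero]
  · intro m
    obtain ⟨m, rfl⟩ := K.mkQ_surjective m
    induction m using h.induction with
    | homog t m hm => exact AddSubgroup.mem_iSup_of_mem t ⟨m, hm, rfl⟩
    | add x y hx hy => rw [map_add]; exact add_mem hx hy
  · rintro p d t _ hp ⟨m, hm, rfl⟩
    exact ⟨p • m, h.2 p d t m hp hm, rfl⟩

end grading

section free
variable {ι : Type}

variable (k σ) in
/-- The degree-`t` piece of a free module with twists `tw`. -/
def freeGr (tw : ι → ℤ) (t : ℤ) : AddSubgroup (ι → MvPolynomial σ k) where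
  carrier := {v | ∀ l, homogZ k (v l) (t - tw l)}
  add_mem' := fun ha hb l => (ha l).add (hb l)
  zero_mem' := fun _ => homogZ_zero
  neg_mem' := fun ha l => (ha l).neg

lemma single_mem_freeGr [DecidableEq ι] {tw : ι → ℤ} {t : ℤ} {l : ι} {p : MvPolynomial σ k}
    (hp : homogZ k p (t - tw l)) : Pi.single l p ∈ freeGr k σ tw t := by
  intro l'
  by_cases hl : l' = l
  · subst hl; rwa [Pi.single_eq_same]
  · rw [Pi.single_eq_of_ne hl]; exact homogZ_zero

lemma isGrading_freeGr [Finite ι] (tw : ι → ℤ) : IsGrading k σ (freeGr k σ tw) := by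
  classical
  have := Fintype.ofFinite ι
  let π : ℤ → (ι → MvPolynomial σ k) →+ (ι → MvPolynomial σ k) := fun t =>
    { toFun := fun v l => polyProj k σ (t - tw l) (v l)
      map_zero' := by ext1; simp
      map_add' := fun x y => by ext1; simp }
  refine IsGrading.of_proj π (fun t v hv => ?_) (fun s t hst v hv => ?_) (fun v => ?_)
    (fun p d t v hp hv l => ?_)
  · ext1 l
    exact polyProj_of_homogZ (hv l)
  · ext1 l
    exact polyProj_of_homogZ_ne (hv l) (by omega)
  · rw [← Finset.univ_sum_single v]
    refine sum_mem fun l _ => ?_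
    rw [← sum_homogeneousComponent (v l)]
    have : ∀ s : Finset ℕ, Pi.single l (∑ i ∈ s, homogeneousComponent i (v l)) =
        ∑ i ∈ s, (Pi.single l (homogeneousComponent i (v l)) : ι → MvPolynomial σ k) := fun s =>
      map_sum (AddMonoidHom.single (fun _ : ι => MvPolynomial σ k) l) _ _
    rw [this]
    refine sum_mem fun i _ => AddSubgroup.mem_iSup_of_mem (i + tw l) (single_mem_freeGr ?_)
    rw [add_sub_cancel_right]
    exact homogZ_of_isHomogeneous (homogeneousComponent_isHomogeneous i _)
  · have := (homogZ_of_isHomogeneous hp).mul (hv l)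
    rwa [show t + d - tw l = d + (t - tw l) by ring]

lemma freeGr_hom [Fintype ι] [DecidableEq ι] {M : Type} [AddCommGroup M]
    [Module (MvPolynomial σ k) M] {gr : ℤ → AddSubgroup M} (h : IsGrading k σ gr) {tw : ι → ℤ}
    {f : (ι → MvPolynomial σ k) →ₗ[MvPolynomial σ k] M}
    (hf : ∀ l, f (Pi.single l 1) ∈ gr (tw l)) (t : ℤ) :
    ∀ v ∈ freeGr k σ tw t, f v ∈ gr t := by
  intro v hv
  rw [pi_eq_sum_univ' v, map_sum]
  refine sum_mem fun l _ => ?_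
  rw [map_smul]
  have := h.smul_mem (hv l) (hf l)
  rw [add_sub_cancel] at this
  convert this using 4

end free
end

section
variable {k : Type} [Field k] {σ : Type}

/-- The grading on the kernel of a map from a free module with twists `tw`. -/
noncomputable def kerGr {ι M : Type} [AddCommGroup M] [Module (MvPolynomial σ k) M] (tw : ι → ℤ)
    (f : (ι → MvPolynomial σ k) →ₗ[MvPolynomial σ k] M) (t : ℤ) :
    AddSubgroup (LinearMap.ker f) :=
  (freeGr k σ tw t).comap (LinearMap.ker f).subtype.toAddMonoidHom

lemma isGrading_kerGr {ι M : Type} [Fintype ι] [DecidableEq ι] [AddCommGroup M]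
    [Module (MvPolynomial σ k) M] {gr : ℤ → AddSubgroup M} (h : IsGrading k σ gr) {tw : ι → ℤ}
    {f : (ι → MvPolynomial σ k) →ₗ[MvPolynomial σ k] M}
    (hf : ∀ l, f (Pi.single l 1) ∈ gr (tw l)) : IsGrading k σ (kerGr tw f) :=
  (isGrading_freeGr tw).ker h f (freeGr_hom h hf)

variable (k σ) in
/-- `M` has a graded free resolution of length at most `n` whose `i`-th step has generators in
degrees at most `c + i`. -/
def HasRes : ℕ → ℤ → ∀ (M : Type) [AddCommGroup M] [Module (MvPolynomial σ k) M]
    (_ : ℤ → AddSubgroup M), Prop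
  | 0, _, M, _, _, _ => Subsingleton M
  | n + 1, c, M, _, _, gr => ∃ (m : ℕ) (tw : Fin m → ℤ)
      (f : (Fin m → MvPolynomial σ k) →ₗ[MvPolynomial σ k] M), Function.Surjective f ∧
      (∀ l, f (Pi.single l 1) ∈ gr (tw l)) ∧ (∀ l, tw l ≤ c) ∧
      HasRes n (c + 1) (LinearMap.ker f) (kerGr tw f)

lemma HasRes.congr {n : ℕ} : ∀ {c : ℤ} {M M' : Type} [AddCommGroup M]
    [Module (MvPolynomial σ k) M] [AddCommGroup M'] [Module (MvPolynomial σ k) M']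
    {gr : ℤ → AddSubgroup M} {gr' : ℤ → AddSubgroup M'} (e : M ≃ₗ[MvPolynomial σ k] M')
    (_ : ∀ t, ∀ m ∈ gr t, e m ∈ gr' t) (_ : HasRes k σ n c M gr), HasRes k σ n c M' gr' := by
  induction n with
  | zero => intro c M M' _ _ _ _ gr gr' e he h; exact (e.toEquiv.subsingleton_congr).1 h
  | succ n ih =>
    rintro c M M' _ _ _ _ gr gr' e he ⟨m, tw, f, h1, h2, h3, h4⟩
    refine ⟨m, tw, e.toLinearMap ∘ₗ f, e.surjective.comp h1, fun l => he _ _ (h2 l), h3, ?_⟩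
    exact ih (LinearEquiv.ofEq _ _ (LinearEquiv.ker_comp e f).symm) (fun _ _ h => h) h4

lemma HasRes.of_subsingleton (n : ℕ) : ∀ {c : ℤ} {M : Type} [AddCommGroup M]
    [Module (MvPolynomial σ k) M] {gr : ℤ → AddSubgroup M} [Subsingleton M],
    HasRes k σ n c M gr := by
  induction n with
  | zero => intro c M _ _ gr hM; exact hM
  | succ n ih =>
    intro c M _ _ gr hM
    exact ⟨0, Fin.elim0, 0, fun m => ⟨0, Subsingleton.elim _ _⟩, fun l => l.elim0,
      fun l => l.elim0, ih⟩

lemma HasRes.mono {n : ℕ} : ∀ {n' : ℕ} {c c' : ℤ} {M : Type} [AddCommGroup M]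
    [Module (MvPolynomial σ k) M] {gr : ℤ → AddSubgroup M} (_ : n ≤ n') (_ : c ≤ c')
    (_ : HasRes k σ n c M gr), HasRes k σ n' c' M gr := by
  induction n with
  | zero =>
    intro n' c c' M _ _ gr _ _ h
    have : Subsingleton M := h
    exact HasRes.of_subsingleton n'
  | succ n ih =>
    rintro n' c c' M _ _ gr hn hc ⟨m, tw, f, h1, h2, h3, h4⟩
    obtain ⟨n', rfl⟩ : ∃ l, n' = l + 1 := ⟨n' - 1, by omega⟩
    exact ⟨m, tw, f, h1, h2, fun l => (h3 l).trans hc, ih (by omega) (by omega) h4⟩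

/-- A resolution can start with a free module on any finite index type. -/
lemma HasRes.succ_of {n : ℕ} {c : ℤ} {M : Type} [AddCommGroup M] [Module (MvPolynomial σ k) M]
    {gr : ℤ → AddSubgroup M} {ι : Type} [Fintype ι] [DecidableEq ι] (tw : ι → ℤ)
    (f : (ι → MvPolynomial σ k) →ₗ[MvPolynomial σ k] M) (h1 : Function.Surjective f)
    (h2 : ∀ l, f (Pi.single l 1) ∈ gr (tw l)) (h3 : ∀ l, tw l ≤ c)
    (h4 : HasRes k σ n (c + 1) (LinearMap.ker f) (kerGr tw f)) : HasRes k σ (n + 1) c M gr := by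
  let e := Fintype.equivFin ι
  let E : (Fin (Fintype.card ι) → MvPolynomial σ k) ≃ₗ[MvPolynomial σ k] (ι → MvPolynomial σ k) :=
    LinearEquiv.funCongrLeft _ _ e
  refine ⟨Fintype.card ι, tw ∘ e.symm, f ∘ₗ E.toLinearMap, h1.comp E.surjective, fun l => ?_,
    fun l => h3 _, ?_⟩
  · have : E (Pi.single l 1) = Pi.single (e.symm l) 1 := by
      ext1 i
      change (Pi.single l 1 : Fin _ → MvPolynomial σ k) (e i) = _
      rw [Pi.single_apply, Pi.single_apply]
      simp [Equiv.eq_symm_apply]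
    change f (E (Pi.single l 1)) ∈ _
    rw [this]
    exact h2 _
  · have hE : Submodule.map E.symm.toLinearMap (LinearMap.ker f) =
        LinearMap.ker (f ∘ₗ E.toLinearMap) := by
      ext v
      rw [LinearMap.mem_ker]
      constructor
      · rintro ⟨w, hw, rfl⟩
        change f (E (E.symm w)) = 0
        rw [E.apply_symm_apply]; exact hw
      · intro hv
        exact ⟨E v, hv, E.symm_apply_apply v⟩
    refine h4.congr ((E.symm.submoduleMap (LinearMap.ker f)).trans (LinearEquiv.ofEq _ _ hE)) ?_
    intro t v hv l
    exact hv (e.symm l)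

section horseshoe
variable {M' M M'' : Type} [AddCommGroup M'] [Module (MvPolynomial σ k) M']
  [AddCommGroup M] [Module (MvPolynomial σ k) M] [AddCommGroup M'']
  [Module (MvPolynomial σ k) M''] {gr' : ℤ → AddSubgroup M'} {gr : ℤ → AddSubgroup M}
  {gr'' : ℤ → AddSubgroup M''}

/-- The horseshoe lemma. -/
lemma HasRes.extension {n : ℕ} : ∀ {c : ℤ} {M' M M'' : Type} [AddCommGroup M']
    [Module (MvPolynomial σ k) M'] [AddCommGroup M] [Module (MvPolynomial σ k) M]
    [AddCommGroup M''] [Module (MvPolynomial σ k) M''] {gr' : ℤ → AddSubgroup M'}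
    {gr : ℤ → AddSubgroup M} {gr'' : ℤ → AddSubgroup M''} (_ : IsGrading k σ gr')
    (_ : IsGrading k σ gr) (_ : IsGrading k σ gr'') (f : M' →ₗ[MvPolynomial σ k] M)
    (g : M →ₗ[MvPolynomial σ k] M'') (_ : ∀ t, ∀ m ∈ gr' t, f m ∈ gr t)
    (_ : ∀ t, ∀ m ∈ gr t, g m ∈ gr'' t) (_ : Function.Injective f) (_ : Function.Surjective g)
    (_ : Function.Exact f g) (_ : HasRes k σ n c M' gr') (_ : HasRes k σ n c M'' gr''),
    HasRes k σ n c M gr := by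
  induction n with
  | zero =>
    intro c M' M M'' _ _ _ _ _ _ gr' gr gr'' G' G G'' f g hf hg hfi hgs hfg h' h''
    have : Subsingleton M' := h'
    have : Subsingleton M'' := h''
    refine subsingleton_of_forall_eq 0 fun m => ?_
    obtain ⟨m', rfl⟩ := (hfg m).1 (Subsingleton.elim _ _)
    rw [Subsingleton.elim m' 0, map_zero]
  | succ n ih =>
    rintro c M' M M'' _ _ _ _ _ _ gr' gr gr'' G' G G'' f g hf hg hfi hgs hfg
      ⟨a, tw', p', hp1, hp2, hp3, hp4⟩ ⟨b, tw'', p'', hq1, hq2, hq3, hq4⟩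
    have hlift : ∀ l, ∃ m ∈ gr (tw'' l), g m = p'' (Pi.single l 1) := by
      intro l
      obtain ⟨m, hm⟩ := hgs (p'' (Pi.single l 1))
      rw [← hm]
      exact G.surj_degreewise G'' g.toAddMonoidHom hg
        (show g m ∈ _ by rw [hm]; exact hq2 l)
    choose s hs1 hs2 using hlift
    let S := Fintype.linearCombination (MvPolynomial σ k) s
    have hS1 : ∀ l, S (Pi.single l 1) = s l := fun l => by
      simp [S, Fintype.linearCombination_apply_single]
    have hS : ∀ v, g (S v) = p'' v := by
      intro v
      have : g ∘ₗ S = p'' := by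
        refine LinearMap.pi_ext' fun l => LinearMap.ext_ring ?_
        simp only [LinearMap.comp_apply, LinearMap.single_apply, hS1, hs2]
      rw [← this]; rfl
    let L : (Fin a ⊕ Fin b → MvPolynomial σ k) →ₗ[MvPolynomial σ k]
        (Fin a → MvPolynomial σ k) := LinearMap.funLeft _ _ Sum.inl
    let R : (Fin a ⊕ Fin b → MvPolynomial σ k) →ₗ[MvPolynomial σ k]
        (Fin b → MvPolynomial σ k) := LinearMap.funLeft _ _ Sum.inr
    let P := f ∘ₗ p' ∘ₗ L + S ∘ₗ R
    have hP : ∀ v, P v = f (p' (v ∘ Sum.inl)) + S (v ∘ Sum.inr) := fun v => rfl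
    have hgf : ∀ m, g (f m) = 0 := fun m => (hfg _).2 ⟨m, rfl⟩
    have hgP : ∀ v, g (P v) = p'' (v ∘ Sum.inr) := by
      intro v
      rw [hP, map_add, hgf, zero_add, hS]
    have hP2 : ∀ l, P (Pi.single l 1) ∈ gr (Sum.elim tw' tw'' l) := by
      rintro (l | l)
      · have e1 : (Pi.single (Sum.inl l) 1 : Fin a ⊕ Fin b → MvPolynomial σ k) ∘ Sum.inl =
            Pi.single l 1 := by
          ext1 i; simp [Pi.single_apply]
        have e2 : (Pi.single (Sum.inl l) 1 : Fin a ⊕ Fin b → MvPolynomial σ k) ∘ Sum.inr =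
            0 := by
          ext1 i; simp
        rw [hP, e1, e2, map_zero, add_zero]
        exact hf _ _ (hp2 l)
      · have e1 : (Pi.single (Sum.inr l) 1 : Fin a ⊕ Fin b → MvPolynomial σ k) ∘ Sum.inr =
            Pi.single l 1 := by
          ext1 i; simp [Pi.single_apply]
        have e2 : (Pi.single (Sum.inr l) 1 : Fin a ⊕ Fin b → MvPolynomial σ k) ∘ Sum.inl =
            0 := by
          ext1 i; simp
        rw [hP, e1, e2, map_zero, map_zero, zero_add, hS1]
        exact hs1 l
    refine HasRes.succ_of (Sum.elim tw' tw'') P (fun m => ?_) hP2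
      (fun l => by rcases l with l | l; exacts [hp3 l, hq3 l]) ?_
    · obtain ⟨v, hv⟩ := hq1 (g m)
      obtain ⟨m', hm'⟩ := (hfg (m - S v)).1 (by rw [map_sub, hS, hv, sub_self])
      obtain ⟨w, rfl⟩ := hp1 m'
      refine ⟨Sum.elim w v, ?_⟩
      rw [hP, Sum.elim_comp_inl, Sum.elim_comp_inr, hm', sub_add_cancel]
    · let F : LinearMap.ker p' →ₗ[MvPolynomial σ k] LinearMap.ker P :=
        { toFun := fun v => ⟨Sum.elim v.1 0, by
            rw [LinearMap.mem_ker, hP, Sum.elim_comp_inl, Sum.elim_comp_inr, v.2, map_zero,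
              map_zero, add_zero]⟩
          map_add' := fun x y => Subtype.ext (by ext1 (i | i) <;> simp)
          map_smul' := fun x y => Subtype.ext (by ext1 (i | i) <;> simp) }
      let Q : LinearMap.ker P →ₗ[MvPolynomial σ k] LinearMap.ker p'' :=
        R.restrict fun v hv => by
          rw [LinearMap.mem_ker] at hv ⊢
          change p'' (v ∘ Sum.inr) = 0
          rw [← hgP, hv, map_zero]
      refine ih (isGrading_kerGr G' hp2) (isGrading_kerGr G hP2) (isGrading_kerGr G'' hq2)
        F Q ?_ ?_ ?_ ?_ ?_ hp4 hq4
      · rintro t v hv (l | l)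
        · exact hv l
        · exact homogZ_zero
      · intro t v hv l
        exact hv (Sum.inr l)
      · intro v w hvw
        apply Subtype.ext
        have := congrArg (fun z => L z.1) hvw
        exact this
      · rintro ⟨v, hv⟩
        rw [LinearMap.mem_ker] at hv
        obtain ⟨m', hm'⟩ := (hfg (S v)).1 (by rw [hS, hv])
        obtain ⟨w, rfl⟩ := hp1 m'
        refine ⟨⟨Sum.elim (-w) v, ?_⟩, rfl⟩
        rw [LinearMap.mem_ker, hP, Sum.elim_comp_inl, Sum.elim_comp_inr, map_neg, map_neg, hm',
          neg_add_cancel]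
      · rintro ⟨v, hv⟩
        constructor
        · intro h
          have h1 : v ∘ Sum.inr = 0 := congrArg Subtype.val h
          rw [LinearMap.mem_ker, hP, h1, map_zero, add_zero] at hv
          refine ⟨⟨v ∘ Sum.inl, hfi (by rw [hv, map_zero])⟩, Subtype.ext ?_⟩
          ext1 (i | i)
          · rfl
          · exact (congrFun h1 i).symm
        · rintro ⟨w, hw⟩
          rw [← hw]
          rfl

/-- The mapping cone of a resolution of a submodule. -/
lemma HasRes.cone {n : ℕ} {c : ℤ} (G' : IsGrading k σ gr') (G : IsGrading k σ gr)
    (G'' : IsGrading k σ gr'') (f : M' →ₗ[MvPolynomial σ k] M) (g : M →ₗ[MvPolynomial σ k] M'')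
    (hf : ∀ t, ∀ m ∈ gr' t, f m ∈ gr t) (hg : ∀ t, ∀ m ∈ gr t, g m ∈ gr'' t)
    (hfi : Function.Injective f) (hgs : Function.Surjective g) (hfg : Function.Exact f g)
    (h' : HasRes k σ n (c + 1) M' gr') (h : HasRes k σ (n + 1) c M gr) :
    HasRes k σ (n + 1) c M'' gr'' := by
  obtain ⟨m, tw, p, hp1, hp2, hp3, hp4⟩ := h
  have hgp : ∀ l, (g ∘ₗ p) (Pi.single l 1) ∈ gr'' (tw l) := fun l => hg _ _ (hp2 l)
  refine ⟨m, tw, g ∘ₗ p, hgs.comp hp1, hgp, hp3, ?_⟩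
  have hgf : ∀ m, g (f m) = 0 := fun m => (hfg _).2 ⟨m, rfl⟩
  have hex : ∀ v : LinearMap.ker (g ∘ₗ p), ∃ m', f m' = p v := fun v => (hfg _).1 v.2
  let F : LinearMap.ker p →ₗ[MvPolynomial σ k] LinearMap.ker (g ∘ₗ p) :=
    Submodule.inclusion (LinearMap.ker_le_ker_comp p g)
  let e := LinearEquiv.ofInjective f hfi
  let Q : LinearMap.ker (g ∘ₗ p) →ₗ[MvPolynomial σ k] M' :=
    e.symm.toLinearMap ∘ₗ p.restrict (q := LinearMap.range f) fun v hv => (hfg _).1 hv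
  have hQ : ∀ v : LinearMap.ker (g ∘ₗ p), f (Q v) = p v := fun v =>
    congrArg Subtype.val (e.apply_symm_apply ⟨p v, (hfg _).1 v.2⟩)
  refine HasRes.extension (isGrading_kerGr G hp2) (isGrading_kerGr G'' hgp) G' F Q
    (fun t v hv => hv) (fun t v hv => ?_) (Submodule.inclusion_injective _) (fun m' => ?_)
    (fun v => ?_) hp4 h'
  · refine G'.mem_of_injective G f.toAddMonoidHom hf hfi ?_
    change f (Q v) ∈ _
    rw [hQ]
    exact freeGr_hom G hp2 t _ hv
  · obtain ⟨v, hv⟩ := hp1 (f m')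
    exact ⟨⟨v, by rw [LinearMap.mem_ker, LinearMap.comp_apply, hv, hgf]⟩, hfi (by rw [hQ, hv])⟩
  · constructor
    · intro h
      refine ⟨⟨v, ?_⟩, rfl⟩
      rw [LinearMap.mem_ker, ← hQ, h, map_zero]
    · rintro ⟨w, rfl⟩
      apply hfi
      rw [hQ, map_zero]
      exact w.2

end horseshoe

section resolution

lemma HasRes.exists_gradedFreeRes {n : ℕ} : ∀ {c : ℤ} {M : Type} [AddCommGroup M]
    [Module (MvPolynomial σ k) M] {gr : ℤ → AddSubgroup M} (_ : HasRes k σ n c M gr),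
    ∃ F : GradedFreeRes k σ M gr, ∀ i (l : Fin (F.rk i)), F.tw i l - (i : ℤ) ≤ c := by
  induction n with
  | zero =>
    intro c M _ _ gr h
    have : Subsingleton M := h
    exact ⟨{  rk := fun _ => 0
              tw := fun _ l => l.elim0
              bdd := ⟨0, fun _ _ => rfl⟩
              aug := 0
              d := fun _ => 0
              aug_surj := fun m => ⟨0, Subsingleton.elim _ _⟩
              exact_zero := Subsingleton.elim _ _
              exact_succ := fun _ => Subsingleton.elim _ _
              aug_homog := fun l => l.elim0
              d_homog := fun _ l => l.elim0 }, fun i l => l.elim0⟩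
  | succ n ih =>
    rintro c M _ _ gr ⟨m, tw, f, h1, h2, h3, h4⟩
    obtain ⟨F, hF⟩ := ih h4
    refine ⟨{ rk := fun i => Nat.casesOn i m F.rk
              tw := fun i => match i with
                | 0 => tw
                | i + 1 => F.tw i
              bdd := ?_
              aug := f
              d := fun i => match i with
                | 0 => (LinearMap.ker f).subtype ∘ₗ F.aug
                | i + 1 => F.d i
              aug_surj := h1
              exact_zero := ?_
              exact_succ := fun i => match i with
                | 0 => ?_
                | i + 1 => F.exact_succ i
              aug_homog := h2
              d_homog := fun i => match i with
                | 0 => fun l => F.aug_homog l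
                | i + 1 => F.d_homog i }, ?_⟩
    · obtain ⟨N, hN⟩ := F.bdd
      refine ⟨N + 1, fun i hi => ?_⟩
      obtain ⟨i, rfl⟩ : ∃ l, i = l + 1 := ⟨i - 1, by omega⟩
      exact hN i (by omega)
    · change LinearMap.range ((LinearMap.ker f).subtype ∘ₗ F.aug) = _
      rw [LinearMap.range_comp, LinearMap.range_eq_top.2 F.aug_surj, Submodule.map_top,
        Submodule.range_subtype]
    · change LinearMap.range (F.d 0) = LinearMap.ker ((LinearMap.ker f).subtype ∘ₗ F.aug)
      rw [F.exact_zero, LinearMap.ker_comp_of_ker_eq_bot _ (Submodule.ker_subtype _)]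
    · intro i l
      cases i with
      | zero => simpa using h3 l
      | succ i =>
        have : F.tw i l - i ≤ c + 1 := hF i l
        change F.tw i l - ((i + 1 : ℕ) : ℤ) ≤ c
        push_cast
        linarith

lemma hasRes_of_gradedFreeRes {N : ℕ} : ∀ {c : ℤ} {M : Type} [AddCommGroup M]
    [Module (MvPolynomial σ k) M] {gr : ℤ → AddSubgroup M} (F : GradedFreeRes k σ M gr)
    (_ : ∀ i, N ≤ i → F.rk i = 0) (_ : ∀ i (l : Fin (F.rk i)), F.tw i l - (i : ℤ) ≤ c),
    HasRes k σ N c M gr := by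
  induction N with
  | zero =>
    intro c M _ _ gr F h0 hc
    have : IsEmpty (Fin (F.rk 0)) := by rw [h0 0 le_rfl]; infer_instance
    exact F.aug_surj.subsingleton
  | succ N ih =>
    intro c M _ _ gr F h0 hc
    refine ⟨F.rk 0, F.tw 0, F.aug, F.aug_surj, F.aug_homog, fun l => by simpa using hc 0 l, ?_⟩
    have hd : ∀ v, F.d 0 v ∈ LinearMap.ker F.aug := fun v => by
      rw [← F.exact_zero]; exact ⟨v, rfl⟩
    refine ih { rk := fun i => F.rk (i + 1)
                tw := fun i => F.tw (i + 1)
                bdd := ⟨N, fun i hi => h0 (i + 1) (by omega)⟩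
                aug := (F.d 0).codRestrict _ hd
                d := fun i => F.d (i + 1)
                aug_surj := ?_
                exact_zero := ?_
                exact_succ := fun i => F.exact_succ (i + 1)
                aug_homog := fun l => F.d_homog 0 l
                d_homog := fun i => F.d_homog (i + 1) } (fun i hi => h0 (i + 1) (by omega)) ?_
    · rintro ⟨v, hv⟩
      rw [← F.exact_zero] at hv
      obtain ⟨w, rfl⟩ := hv
      exact ⟨w, rfl⟩
    · rw [LinearMap.ker_codRestrict]
      exact F.exact_succ 0
    · intro i l
      have := hc (i + 1) l
      push_cast at this
      change F.tw (i + 1) l - (i : ℤ) ≤ c + 1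
      linarith

end resolution
end

section
variable {k : Type} [Field k] {σ τ : Type}

/-- Compatibility with a grading can be checked on constants and variables. -/
lemma smul_mem_of_X {M : Type} [AddCommGroup M] [Module (MvPolynomial σ k) M]
    {gr : ℤ → AddSubgroup M} (hC : ∀ c t, ∀ m ∈ gr t, (C c : MvPolynomial σ k) • m ∈ gr t)
    (hX : ∀ i t, ∀ m ∈ gr t, (X i : MvPolynomial σ k) • m ∈ gr (t + 1))
    (p : MvPolynomial σ k) (d : ℕ) (t : ℤ) (m : M) (hp : p.IsHomogeneous d) (hm : m ∈ gr t) :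
    p • m ∈ gr (t + d) := by
  have hXn : ∀ i (n : ℕ) t, ∀ m ∈ gr t, (X i ^ n : MvPolynomial σ k) • m ∈ gr (t + n) := by
    intro i n
    induction n with
    | zero => intro t m hm; simpa using hm
    | succ n ih =>
      intro t m hm
      rw [pow_succ', mul_smul, Nat.cast_succ, ← add_assoc]
      exact hX _ _ _ (ih t m hm)
  have hmon : ∀ (e : σ →₀ ℕ) t, ∀ m ∈ gr t,
      (monomial e (1 : k) : MvPolynomial σ k) • m ∈ gr (t + e.degree) := by
    intro e
    induction e using Finsupp.induction_linear with
    | zero => intro t m hm; simpa using hm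
    | add e f he hf =>
      intro t m hm
      rw [← one_mul (1 : k), ← monomial_mul, mul_smul, map_add, add_comm (Finsupp.degree e),
        Nat.cast_add, ← add_assoc]
      exact he _ _ (hf _ _ hm)
    | single i n =>
      intro t m hm
      rw [← X_pow_eq_monomial, Finsupp.degree_single]
      exact hXn i n t m hm
  rw [p.as_sum, Finset.sum_smul]
  refine sum_mem fun e he => ?_
  have hd : e.degree = d := by
    have h1 := hp (mem_support_iff.1 he)
    rwa [Finsupp.degree_eq_weight_one]
  rw [← mul_one (coeff e p), ← C_mul_monomial, mul_smul, ← hd]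
  exact hC _ _ _ (hmon e t m hm)

section ext
variable {M N : Type} [AddCommGroup M] [Module k M] [Module (MvPolynomial σ k) M]
  [IsScalarTower k (MvPolynomial σ k) M] [AddCommGroup N] [Module k N]
  [Module (MvPolynomial τ k) N] [IsScalarTower k (MvPolynomial τ k) N]

lemma C_smul_eq (c : k) (m : M) : (C c : MvPolynomial σ k) • m = c • m :=
  algebraMap_smul (MvPolynomial σ k) c m

lemma ExtT.tm_add_left (m m' : M) (n : N) :
    tm k σ τ (m + m') n = tm k σ τ m n + tm k σ τ m' n := TensorProduct.add_tmul _ _ _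

lemma ExtT.tm_add_right (m : M) (n n' : N) :
    tm k σ τ m (n + n') = tm k σ τ m n + tm k σ τ m n' := TensorProduct.tmul_add _ _ _

variable (k σ τ) in
/-- The grading on an external tensor product. -/
noncomputable def extGr (gr : ℤ → AddSubgroup M) (gr' : ℤ → AddSubgroup N) (t : ℤ) :
    AddSubgroup (ExtT k σ τ M N) :=
  AddSubgroup.closure {x | ∃ a b, a + b = t ∧ ∃ m ∈ gr a, ∃ n ∈ gr' b, ExtT.tm k σ τ m n = x}

variable {gr : ℤ → AddSubgroup M} {gr' : ℤ → AddSubgroup N}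

lemma tm_mem_extGr {a b : ℤ} {m : M} (hm : m ∈ gr a) {n : N} (hn : n ∈ gr' b) :
    ExtT.tm k σ τ m n ∈ extGr k σ τ gr gr' (a + b) :=
  AddSubgroup.subset_closure ⟨a, b, rfl, m, hm, n, hn, rfl⟩

lemma map_mem_of_mem_extGr {T : Type} [AddCommGroup T] {grT : ℤ → AddSubgroup T}
    (f : ExtT k σ τ M N →+ T)
    (hf : ∀ a b, ∀ m ∈ gr a, ∀ n ∈ gr' b, f (ExtT.tm k σ τ m n) ∈ grT (a + b)) (t : ℤ) :
    ∀ x ∈ extGr k σ τ gr gr' t, f x ∈ grT t := by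
  intro x hx
  have : extGr k σ τ gr gr' t ≤ (grT t).comap f := by
    rw [extGr, AddSubgroup.closure_le]
    rintro _ ⟨a, b, rfl, m, hm, n, hn, rfl⟩
    exact hf a b m hm n hn
  exact this hx

/-- The decomposition into homogeneous components, as a linear map. -/
noncomputable def IsGrading.decL (h : IsGrading k σ gr) : M →ₗ[k] (ℤ →₀ M) :=
  { h.dec with
    map_smul' := fun c m => by
      change h.dec (c • m) = c • h.dec m
      induction m using h.induction with
      | homog t m hm =>
        have := h.smul_mem (homogZ_of_isHomogeneous (isHomogeneous_C σ c)) hm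
        rw [C_smul_eq, Nat.cast_zero, add_zero] at this
        rw [h.dec_of_mem hm, h.dec_of_mem this, Finsupp.smul_single]
      | add x y hx hy => rw [smul_add, map_add, map_add, hx, hy, smul_add] }

lemma IsGrading.decL_of_mem (h : IsGrading k σ gr) {t : ℤ} {m : M} (hm : m ∈ gr t) :
    h.decL m = Finsupp.single t m := h.dec_of_mem hm

lemma IsGrading.extT (h : IsGrading k σ gr) (h' : IsGrading k τ gr') :
    IsGrading k (σ ⊕ τ) (extGr k σ τ gr gr') := by
  let δ : M ⊗[k] N →ₗ[k] (ℤ →₀ M ⊗[k] N) :=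
    Finsupp.lmapDomain _ k (fun p : ℤ × ℤ => p.1 + p.2) ∘ₗ
      (finsuppTensorFinsupp k k M N ℤ ℤ).toLinearMap ∘ₗ TensorProduct.map h.decL h'.decL
  have hδ : ∀ a b, ∀ m ∈ gr a, ∀ n ∈ gr' b, δ (m ⊗ₜ n) = Finsupp.single (a + b) (m ⊗ₜ n) := by
    intro a b m hm n hn
    simp only [δ, LinearMap.comp_apply, TensorProduct.map_tmul, h.decL_of_mem hm,
      h'.decL_of_mem hn, LinearEquiv.coe_coe, finsuppTensorFinsupp_single,
      Finsupp.lmapDomain_apply, Finsupp.mapDomain_single]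
  let π : ℤ → ExtT k σ τ M N →+ ExtT k σ τ M N := fun t =>
    (Finsupp.applyAddHom t).comp δ.toAddMonoidHom
  have hπ : ∀ t a b, ∀ m ∈ gr a, ∀ n ∈ gr' b,
      π t (ExtT.tm k σ τ m n) = if a + b = t then ExtT.tm k σ τ m n else 0 := by
    intro t a b m hm n hn
    change δ (m ⊗ₜ n) t = _
    rw [hδ a b m hm n hn, Finsupp.single_apply]
    rfl
  refine IsGrading.of_proj π ?_ ?_ (fun x => ?_) (smul_mem_of_X ?_ ?_)
  · intro t x hx
    induction hx using AddSubgroup.closure_induction with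
    | mem x hx =>
      obtain ⟨a, b, hab, m, hm, n, hn, rfl⟩ := hx
      rw [hπ t a b m hm n hn, if_pos hab]
    | zero => rw [map_zero]
    | add x y _ _ hx hy => rw [map_add, hx, hy]
    | neg x _ hx => rw [map_neg, hx]
  · intro s t hst x hx
    induction hx using AddSubgroup.closure_induction with
    | mem x hx =>
      obtain ⟨a, b, hab, m, hm, n, hn, rfl⟩ := hx
      rw [hπ s a b m hm n hn, if_neg (by omega)]
    | zero => rw [map_zero]
    | add x y _ _ hx hy => rw [map_add, hx, hy, add_zero]
    | neg x _ hx => rw [map_neg, hx, neg_zero]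
  · induction x using ExtT.induction_on with
    | zero => exact zero_mem _
    | add x y hx hy => exact add_mem hx hy
    | tm m n =>
      induction m using h.induction with
      | add x y hx hy => rw [ExtT.tm_add_left]; exact add_mem hx hy
      | homog a m hm =>
        induction n using h'.induction with
        | add x y hx hy => rw [ExtT.tm_add_right]; exact add_mem hx hy
        | homog b n hn => exact AddSubgroup.mem_iSup_of_mem (a + b) (tm_mem_extGr hm hn)
  · intro c t
    refine map_mem_of_mem_extGr
      (DistribSMul.toAddMonoidHom (ExtT k σ τ M N) (C c : MvPolynomial (σ ⊕ τ) k)) ?_ t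
    intro a b m hm n hn
    have := h.smul_mem (homogZ_of_isHomogeneous (isHomogeneous_C σ c)) hm
    rw [Nat.cast_zero, add_zero] at this
    change (C c : MvPolynomial (σ ⊕ τ) k) • ExtT.tm k σ τ m n ∈ _
    rw [← rename_C (Sum.inl : σ → σ ⊕ τ), ExtT.smul_inl_tm]
    exact tm_mem_extGr this hn
  · rintro (i | i) t
    · refine map_mem_of_mem_extGr (grT := fun t => extGr k σ τ gr gr' (t + 1))
        (DistribSMul.toAddMonoidHom (ExtT k σ τ M N) (X (Sum.inl i) : MvPolynomial (σ ⊕ τ) k)) ?_ t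
      intro a b m hm n hn
      change (X (Sum.inl i) : MvPolynomial (σ ⊕ τ) k) • ExtT.tm k σ τ m n ∈ _
      rw [← rename_X, ExtT.smul_inl_tm, add_right_comm]
      exact tm_mem_extGr (h.2 _ 1 _ _ (isHomogeneous_X k i) hm) hn
    · refine map_mem_of_mem_extGr (grT := fun t => extGr k σ τ gr gr' (t + 1))
        (DistribSMul.toAddMonoidHom (ExtT k σ τ M N) (X (Sum.inr i) : MvPolynomial (σ ⊕ τ) k)) ?_ t
      intro a b m hm n hn
      change (X (Sum.inr i) : MvPolynomial (σ ⊕ τ) k) • ExtT.tm k σ τ m n ∈ _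
      rw [← rename_X, ExtT.smul_inr_tm, add_assoc]
      exact tm_mem_extGr hm (h'.2 _ 1 _ _ (isHomogeneous_X k i) hn)

end ext
end

section
variable {k : Type} [Field k] {σ τ : Type}

section free
variable {p q : ℕ}

variable (k σ τ p q) in
/-- The external tensor product of free modules maps to a free module. -/
noncomputable def freeTensorMap : ExtT k σ τ (Fin p → MvPolynomial σ k) (Fin q → MvPolynomial τ k)
    →ₗ[MvPolynomial (σ ⊕ τ) k] (Fin p × Fin q → MvPolynomial (σ ⊕ τ) k) :=
  let F : ExtT k σ τ (Fin p → MvPolynomial σ k) (Fin q → MvPolynomial τ k) →+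
      (Fin p × Fin q → MvPolynomial (σ ⊕ τ) k) :=
    (TensorProduct.lift (LinearMap.mk₂ k (fun (u : Fin p → MvPolynomial σ k)
      (v : Fin q → MvPolynomial τ k) (l : Fin p × Fin q) =>
        rename (Sum.inl : σ → σ ⊕ τ) (u l.1) * rename (Sum.inr : τ → σ ⊕ τ) (v l.2))
      (fun u u' v => by ext1 l; simp [add_mul]) (fun c u v => by ext1 l; simp)
      (fun u v v' => by ext1 l; simp [mul_add]) (fun c u v => by ext1 l; simp))).toAddMonoidHom
  have hF : ∀ u v, F (ExtT.tm k σ τ u v) = fun l =>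
    rename (Sum.inl : σ → σ ⊕ τ) (u l.1) * rename (Sum.inr : τ → σ ⊕ τ) (v l.2) := fun u v => rfl
  { F with
    map_smul' := map_smul_of_split F
      (fun a t => by
        induction t using ExtT.induction_on with
        | zero => simp
        | add x y hx hy => rw [smul_add, map_add, map_add, hx, hy, smul_add]
        | tm m n =>
          rw [ExtT.smul_inl_tm, hF, hF]
          ext1 l; simp [mul_assoc])
      (fun a t => by
        induction t using ExtT.induction_on with
        | zero => simp
        | add x y hx hy => rw [smul_add, map_add, map_add, hx, hy, smul_add]
        | tm m n =>
          rw [ExtT.smul_inr_tm, hF, hF]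
          ext1 l; simp [mul_left_comm]) }

lemma freeTensorMap_tm (u : Fin p → MvPolynomial σ k) (v : Fin q → MvPolynomial τ k) :
    freeTensorMap k σ τ p q (ExtT.tm k σ τ u v) = fun l =>
      rename (Sum.inl : σ → σ ⊕ τ) (u l.1) * rename (Sum.inr : τ → σ ⊕ τ) (v l.2) := rfl

lemma hasRes_free_extT_free {c d : ℤ} {tw : Fin p → ℤ} {tw' : Fin q → ℤ} (hc : ∀ l, tw l ≤ c)
    (hd : ∀ l, tw' l ≤ d) : HasRes k (σ ⊕ τ) 1 (c + d)
      (ExtT k σ τ (Fin p → MvPolynomial σ k) (Fin q → MvPolynomial τ k))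
      (extGr k σ τ (freeGr k σ tw) (freeGr k τ tw')) := by
  let b : Fin p × Fin q → ExtT k σ τ (Fin p → MvPolynomial σ k) (Fin q → MvPolynomial τ k) :=
    fun l => ExtT.tm k σ τ (Pi.single l.1 1) (Pi.single l.2 1)
  let Φ := Fintype.linearCombination (MvPolynomial (σ ⊕ τ) k) b
  have hΦ : ∀ l, Φ (Pi.single l 1) = b l := fun l => by
    simp [Φ, Fintype.linearCombination_apply_single]
  have hid : freeTensorMap k σ τ p q ∘ₗ Φ = LinearMap.id := by
    refine LinearMap.pi_ext' fun l => LinearMap.ext_ring ?_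
    simp only [LinearMap.comp_apply, LinearMap.single_apply, hΦ, b, freeTensorMap_tm,
      LinearMap.id_apply]
    ext1 l'
    simp only [Pi.single_apply, Prod.ext_iff]
    split_ifs <;> simp_all
  have hinj : Function.Injective Φ :=
    Function.LeftInverse.injective (g := freeTensorMap k σ τ p q) fun v =>
      congrArg (fun f => f v) hid
  refine HasRes.succ_of (fun l => tw l.1 + tw' l.2) Φ ?_ ?_ (fun l => add_le_add (hc _) (hd _)) ?_
  · intro t
    change t ∈ Set.range Φ
    rw [← LinearMap.coe_range, SetLike.mem_coe]
    induction t using ExtT.induction_on with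
    | zero => exact zero_mem _
    | add x y hx hy => exact add_mem hx hy
    | tm u v =>
      have hu : ∀ s : Finset (Fin p), ExtT.tm k σ τ (∑ i ∈ s, u i • Pi.single i 1) v =
          ∑ i ∈ s, ExtT.tm k σ τ (u i • Pi.single i 1) v := fun s => TensorProduct.sum_tmul _ _ _
      have hv : ∀ (u : Fin p → MvPolynomial σ k) (s : Finset (Fin q)),
          ExtT.tm k σ τ u (∑ i ∈ s, v i • Pi.single i 1) =
          ∑ i ∈ s, ExtT.tm k σ τ u (v i • Pi.single i 1) := fun u s => TensorProduct.tmul_sum _ _ _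
      rw [pi_eq_sum_univ' u, hu]
      refine sum_mem fun i _ => ?_
      rw [← ExtT.smul_inl_tm, pi_eq_sum_univ' v, hv]
      refine Submodule.smul_mem _ _ (sum_mem fun j _ => ?_)
      rw [← ExtT.smul_inr_tm]
      exact Submodule.smul_mem _ _ ⟨Pi.single (i, j) 1, hΦ _⟩
  · intro l
    rw [hΦ]
    exact tm_mem_extGr (single_mem_freeGr (by rw [sub_self]; exact homogZ_one))
      (single_mem_freeGr (by rw [sub_self]; exact homogZ_one))
  · change Subsingleton (LinearMap.ker Φ)
    rw [LinearMap.ker_eq_bot.2 hinj]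
    infer_instance

end free

lemma extT_subsingleton_left {M N : Type} [AddCommGroup M] [Module k M]
    [Module (MvPolynomial σ k) M] [IsScalarTower k (MvPolynomial σ k) M] [AddCommGroup N]
    [Module k N] [Module (MvPolynomial τ k) N] [IsScalarTower k (MvPolynomial τ k) N]
    [Subsingleton M] : Subsingleton (ExtT k σ τ M N) :=
  inferInstanceAs (Subsingleton (M ⊗[k] N))

lemma extT_subsingleton_right {M N : Type} [AddCommGroup M] [Module k M]
    [Module (MvPolynomial σ k) M] [IsScalarTower k (MvPolynomial σ k) M] [AddCommGroup N]
    [Module k N] [Module (MvPolynomial τ k) N] [IsScalarTower k (MvPolynomial τ k) N]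
    [Subsingleton N] : Subsingleton (ExtT k σ τ M N) :=
  inferInstanceAs (Subsingleton (M ⊗[k] N))

lemma ExtT.map_mem_extGr {M N M' N' : Type} [AddCommGroup M] [Module k M]
    [Module (MvPolynomial σ k) M] [IsScalarTower k (MvPolynomial σ k) M] [AddCommGroup N]
    [Module k N] [Module (MvPolynomial τ k) N] [IsScalarTower k (MvPolynomial τ k) N]
    [AddCommGroup M'] [Module k M'] [Module (MvPolynomial σ k) M']
    [IsScalarTower k (MvPolynomial σ k) M'] [AddCommGroup N'] [Module k N']
    [Module (MvPolynomial τ k) N'] [IsScalarTower k (MvPolynomial τ k) N']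
    {gr : ℤ → AddSubgroup M} {grN : ℤ → AddSubgroup N} {gr' : ℤ → AddSubgroup M'}
    {grN' : ℤ → AddSubgroup N'} (f : M →ₗ[MvPolynomial σ k] M') (g : N →ₗ[MvPolynomial τ k] N')
    (hf : ∀ t, ∀ m ∈ gr t, f m ∈ gr' t) (hg : ∀ t, ∀ m ∈ grN t, g m ∈ grN' t) (t : ℤ) :
    ∀ x ∈ extGr k σ τ gr grN t, ExtT.map k σ τ f g x ∈ extGr k σ τ gr' grN' t :=
  map_mem_of_mem_extGr (ExtT.map k σ τ f g).toAddMonoidHom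
    (fun _ _ _ hm _ hn => tm_mem_extGr (hf _ _ hm) (hg _ _ hn)) t

lemma HasRes.free_extT {p : ℕ} {c : ℤ} {tw : Fin p → ℤ} (hc : ∀ l, tw l ≤ c) {n : ℕ} :
    ∀ {d : ℤ} {N : Type} [AddCommGroup N] [Module k N] [Module (MvPolynomial τ k) N]
    [IsScalarTower k (MvPolynomial τ k) N] {gr : ℤ → AddSubgroup N} (_ : IsGrading k τ gr)
    (_ : HasRes k τ n d N gr), HasRes k (σ ⊕ τ) n (c + d)
      (ExtT k σ τ (Fin p → MvPolynomial σ k) N) (extGr k σ τ (freeGr k σ tw) gr) := by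
  induction n with
  | zero =>
    intro d N _ _ _ _ gr _ h
    have : Subsingleton N := h
    exact extT_subsingleton_right
  | succ n ih =>
    rintro d N _ _ _ _ gr G ⟨q, tw', g, h1, h2, h3, h4⟩
    have GF := isGrading_freeGr (k := k) (σ := σ) tw
    have GK := isGrading_kerGr G h2
    refine HasRes.cone (GF.extT GK) (GF.extT (isGrading_freeGr tw')) (GF.extT G)
      (ExtT.map k σ τ LinearMap.id (LinearMap.ker g).subtype) (ExtT.map k σ τ LinearMap.id g)
      (ExtT.map_mem_extGr _ _ (fun _ _ h => h) fun _ _ h => h)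
      (ExtT.map_mem_extGr _ _ (fun _ _ h => h) (freeGr_hom G h2))
      (ExtT.map_injective k σ τ Function.injective_id (Submodule.subtype_injective _))
      (ExtT.map_surjective k σ τ Function.surjective_id h1)
      (ExtT.map_exact_right k σ τ (LinearMap.exact_subtype_ker_map g) h1)
      (by rw [add_assoc]; exact ih GK h4) ?_
    exact (hasRes_free_extT_free hc h3).mono (by omega) le_rfl

lemma HasRes.extT {n : ℕ} : ∀ {m : ℕ} {c d : ℤ} {M N : Type} [AddCommGroup M] [Module k M]
    [Module (MvPolynomial σ k) M] [IsScalarTower k (MvPolynomial σ k) M]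
    [AddCommGroup N] [Module k N] [Module (MvPolynomial τ k) N]
    [IsScalarTower k (MvPolynomial τ k) N] {gr : ℤ → AddSubgroup M} {gr' : ℤ → AddSubgroup N}
    (_ : IsGrading k σ gr) (_ : IsGrading k τ gr') (_ : HasRes k σ n c M gr)
    (_ : HasRes k τ m d N gr'),
    HasRes k (σ ⊕ τ) (n + m) (c + d) (ExtT k σ τ M N) (extGr k σ τ gr gr') := by
  induction n with
  | zero =>
    intro m c d M N _ _ _ _ _ _ _ _ gr gr' _ _ h _
    have : Subsingleton M := h
    have : Subsingleton (ExtT k σ τ M N) := extT_subsingleton_left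
    exact HasRes.of_subsingleton _
  | succ n ih =>
    rintro m c d M N _ _ _ _ _ _ _ _ gr gr' G G' ⟨p, tw, f, h1, h2, h3, h4⟩ h'
    have GF := isGrading_freeGr (k := k) (σ := σ) tw
    have GK := isGrading_kerGr G h2
    rw [add_right_comm]
    refine HasRes.cone (GK.extT G') (GF.extT G') (G.extT G')
      (ExtT.map k σ τ (LinearMap.ker f).subtype LinearMap.id) (ExtT.map k σ τ f LinearMap.id)
      (ExtT.map_mem_extGr _ _ (fun _ _ h => h) fun _ _ h => h)
      (ExtT.map_mem_extGr _ _ (freeGr_hom G h2) fun _ _ h => h)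
      (ExtT.map_injective k σ τ (Submodule.subtype_injective _) Function.injective_id)
      (ExtT.map_surjective k σ τ h1 Function.surjective_id)
      (ExtT.map_exact_left k σ τ (LinearMap.exact_subtype_ker_map f) h1)
      (by rw [add_right_comm]; exact ih GK G' h4 h') ?_
    exact (HasRes.free_extT h3 G' h').mono (by omega) le_rfl

end

section
variable {k : Type} [Field k] {σ : Type} {M : Type} [AddCommGroup M] [Module (MvPolynomial σ k) M]
  {gr : ℤ → AddSubgroup M}

lemma IsGrading.dec_smul (h : IsGrading k σ gr) {p : MvPolynomial σ k} {a : ℤ}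
    (hp : homogZ k p a) (m : M) (t : ℤ) : h.dec (p • m) (t + a) = p • h.dec m t := by
  induction m using h.induction with
  | homog s m hm =>
    rw [h.dec_of_mem hm, h.dec_of_mem (h.smul_mem hp hm), Finsupp.single_apply,
      Finsupp.single_apply]
    by_cases hst : s = t
    · rw [if_pos hst, if_pos (by omega)]
    · rw [if_neg hst, if_neg (by omega), smul_zero]
  | add x y hx hy => simp [hx, hy]

/-- Finitely generated graded modules are graded quotients of free modules. -/
lemma IsGrading.exists_cover (h : IsGrading k σ gr) [Module.Finite (MvPolynomial σ k) M] :
    ∃ (p : ℕ) (tw : Fin p → ℤ) (f : (Fin p → MvPolynomial σ k) →ₗ[MvPolynomial σ k] M),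
      Function.Surjective f ∧ ∀ l, f (Pi.single l 1) ∈ gr (tw l) := by
  classical
  obtain ⟨s, hs⟩ := Module.Finite.fg_top (R := MvPolynomial σ k) (M := M)
  let T : Finset M := s.biUnion fun m => (h.dec m).support.image fun t => h.dec m t
  have hT : ∀ x ∈ T, ∃ t, x ∈ gr t := by
    intro x hx
    obtain ⟨m, _, hm⟩ := Finset.mem_biUnion.1 hx
    obtain ⟨t, _, rfl⟩ := Finset.mem_image.1 hm
    exact ⟨t, h.dec_mem m t⟩
  let e := T.equivFin
  choose tw htw using fun l : Fin T.card => hT (e.symm l) (e.symm l).2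
  let f := Fintype.linearCombination (MvPolynomial σ k) (fun l => ((e.symm l : T) : M))
  have hf : ∀ l, f (Pi.single l 1) = (e.symm l : T) := fun l => by
    simp [f, Fintype.linearCombination_apply_single]
  refine ⟨T.card, tw, f, ?_, fun l => by rw [hf]; exact htw l⟩
  rw [← LinearMap.range_eq_top, ← top_le_iff, ← hs, Submodule.span_le]
  intro m hm
  rw [SetLike.mem_coe, ← h.sum_dec m]
  refine sum_mem fun t ht => ?_
  have hmem : h.dec m t ∈ T :=
    Finset.mem_biUnion.2 ⟨m, hm, Finset.mem_image_of_mem _ ht⟩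
  exact ⟨Pi.single (e ⟨_, hmem⟩) 1, by rw [hf, Equiv.symm_apply_apply]⟩

lemma exists_hasRes_of_isEmpty [IsEmpty σ] [Module.Finite (MvPolynomial σ k) M]
    (h : IsGrading k σ gr) : ∃ n c, HasRes k σ n c M gr := by
  classical
  have hex := h.exists_cover
  let p := Nat.find hex
  obtain ⟨tw, f, hf1, hf2⟩ := Nat.find_spec hex
  obtain ⟨c, hc⟩ := (Set.finite_range tw).bddAbove
  refine ⟨1, c, p, tw, f, hf1, hf2, fun l => hc ⟨l, rfl⟩, ?_⟩
  change Subsingleton (LinearMap.ker f)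
  suffices hk : LinearMap.ker f = ⊥ by rw [hk]; infer_instance
  rw [LinearMap.ker_eq_bot']
  intro v hv
  by_contra hne
  obtain ⟨l, hl⟩ := Function.ne_iff.1 hne
  obtain ⟨p', hp'⟩ : ∃ p', Nat.find hex = p' + 1 := ⟨Nat.find hex - 1, by have := l.2; omega⟩
  have hu : IsUnit (v l) := by
    rw [eq_C_of_isEmpty (v l)]
    refine IsUnit.map C (isUnit_iff_ne_zero.2 fun h0 => hl ?_)
    rw [eq_C_of_isEmpty (v l), h0, map_zero]; rfl
  refine Nat.find_min hex (m := p') (by omega) ?_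
  generalize Nat.find hex = N at *
  subst hp'
  let f' := Fintype.linearCombination (MvPolynomial σ k) (fun i => f (Pi.single (l.succAbove i) 1))
  have hf' : ∀ i, f' (Pi.single i 1) = f (Pi.single (l.succAbove i) 1) := fun i => by
    simp [f', Fintype.linearCombination_apply_single]
  refine ⟨fun i => tw (l.succAbove i), f', ?_, fun i => by rw [hf']; exact hf2 _⟩
  have hmem : ∀ i, f (Pi.single i 1) ∈ LinearMap.range f' := by
    intro i
    rcases Fin.eq_self_or_eq_succAbove l i with rfl | ⟨j, rfl⟩
    · rw [pi_eq_sum_univ' v, map_sum, Fin.sum_univ_succAbove _ i, map_smul] at hv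
      rw [← (LinearMap.range f').smul_mem_iff_of_isUnit hu, eq_neg_of_add_eq_zero_left hv]
      refine neg_mem (sum_mem fun j _ => ?_)
      rw [map_smul]
      exact Submodule.smul_mem _ _ ⟨Pi.single j 1, hf' j⟩
    · exact ⟨Pi.single j 1, hf' j⟩
  intro m
  obtain ⟨w, rfl⟩ := hf1 m
  change _ ∈ LinearMap.range f'
  rw [pi_eq_sum_univ' w, map_sum]
  refine sum_mem fun i _ => ?_
  rw [map_smul]
  exact Submodule.smul_mem _ _ (hmem i)

end

section reduction
variable {k : Type} [Field k] {r : ℕ}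

variable (k r) in
/-- Setting the first variable to zero. -/
noncomputable def redHom : MvPolynomial (Fin (r + 1)) k →ₐ[k] MvPolynomial (Fin r) k :=
  aeval (Fin.cases 0 X)

variable (k r) in
/-- The inclusion of the polynomial ring in all variables but the first. -/
noncomputable abbrev succHom : MvPolynomial (Fin r) k →ₐ[k] MvPolynomial (Fin (r + 1)) k :=
  rename Fin.succ

lemma redHom_succHom (p : MvPolynomial (Fin r) k) : redHom k r (succHom k r p) = p := by
  have : (redHom k r).comp (succHom k r) = AlgHom.id k _ := by ext1 i; simp [redHom]
  exact congrArg (fun f => f p) this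

lemma redHom_X_zero : redHom k r (X 0) = 0 := by simp [redHom]

lemma exists_eq_succHom_add (p : MvPolynomial (Fin (r + 1)) k) :
    ∃ w, p = succHom k r (redHom k r p) + X 0 * w := by
  induction p using MvPolynomial.induction_on with
  | C a => exact ⟨0, by simp [redHom]⟩
  | add p q hp hq =>
    obtain ⟨w, hw⟩ := hp
    obtain ⟨w', hw'⟩ := hq
    refine ⟨w + w', ?_⟩
    rw [map_add, map_add, mul_add, add_add_add_comm, ← hw, ← hw']
  | mul_X p i hp =>
    obtain ⟨w, hw⟩ := hp
    cases i using Fin.cases with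
    | zero => exact ⟨p, by rw [map_mul, redHom_X_zero, mul_zero, map_zero, zero_add, mul_comm]⟩
    | succ i =>
      refine ⟨w * X i.succ, ?_⟩
      have : succHom k r (redHom k r (X i.succ)) = X i.succ := by simp [redHom]
      rw [map_mul, map_mul, this, ← mul_assoc, ← add_mul, ← hw]

lemma homogZ.redHom {p : MvPolynomial (Fin (r + 1)) k} {a : ℤ} (hp : homogZ k p a) :
    homogZ k (redHom k r p) a := by
  rcases hp with rfl | ⟨ha, hp⟩
  · rw [map_zero]; exact homogZ_zero
  · refine Or.inr ⟨ha, ?_⟩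
    have := hp.aeval (n := 1) (Fin.cases 0 X : Fin (r + 1) → MvPolynomial (Fin r) k) fun i => by
      cases i using Fin.cases with
      | zero => exact isHomogeneous_zero _ _ _
      | succ i => exact isHomogeneous_X _ _
    rwa [one_mul] at this

variable (k r) in
/-- `q` exhibits `M'` as the reduction of `M` modulo the first variable, which is regular
on `M`. -/
structure IsReduction {M M' : Type} [AddCommGroup M] [Module (MvPolynomial (Fin (r + 1)) k) M]
    [AddCommGroup M'] [Module (MvPolynomial (Fin r) k) M'] (gr : ℤ → AddSubgroup M)
    (gr' : ℤ → AddSubgroup M') (q : M →+ M') : Prop where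
  surj : Function.Surjective q
  map_smul' : ∀ (p : MvPolynomial (Fin (r + 1)) k) (m : M), q (p • m) = redHom k r p • q m
  ker : ∀ m, q m = 0 → ∃ m', m = (X 0 : MvPolynomial (Fin (r + 1)) k) • m'
  graded : ∀ t, ∀ m ∈ gr t, q m ∈ gr' t
  regular : ∀ m : M, (X 0 : MvPolynomial (Fin (r + 1)) k) • m = 0 → m = 0
  bdd : ∃ b : ℤ, ∀ t < b, ∀ m ∈ gr t, m = 0

section
variable {M M' : Type} [AddCommGroup M] [Module (MvPolynomial (Fin (r + 1)) k) M]
    [AddCommGroup M'] [Module (MvPolynomial (Fin r) k) M'] {gr : ℤ → AddSubgroup M}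
    {gr' : ℤ → AddSubgroup M'} {q : M →+ M'}

/-- The graded Nakayama lemma. -/
lemma IsReduction.surjective (Q : IsReduction k r gr gr' q) (h : IsGrading k (Fin (r + 1)) gr) {F : Type}
    [AddCommGroup F] [Module (MvPolynomial (Fin (r + 1)) k) F] {grF : ℤ → AddSubgroup F}
    (hF : IsGrading k (Fin (r + 1)) grF) (f : F →ₗ[MvPolynomial (Fin (r + 1)) k] M)
    (hf : ∀ t, ∀ v ∈ grF t, f v ∈ gr t) (hqf : Function.Surjective fun v => q (f v)) :
    Function.Surjective f := by
  obtain ⟨b, hb⟩ := Q.bdd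
  have key : ∀ n : ℕ, ∀ t < b + n, ∀ m ∈ gr t, m ∈ LinearMap.range f := by
    intro n
    induction n with
    | zero => intro t ht m hm; rw [hb t (by simpa using ht) m hm]; exact zero_mem _
    | succ n ih =>
      intro t ht m hm
      obtain ⟨v, hv⟩ := hqf (q m)
      obtain ⟨m', hm'⟩ := Q.ker (m - f v) (by rw [map_sub, sub_eq_zero]; exact hv.symm)
      have h1 := congrArg (fun z => h.dec z t) hm'
      have h2 := h.dec_smul (homogZ_of_isHomogeneous (isHomogeneous_X k 0)) m' (t - 1)
      have h3 := hF.hom_dec h f.toAddMonoidHom hf v t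
      rw [Nat.cast_one, sub_add_cancel] at h2
      simp only [map_sub, h2, h.dec_of_mem hm, Finsupp.sub_apply, Finsupp.single_eq_same] at h1
      change h.dec (f v) t = f _ at h3
      rw [h3, sub_eq_iff_eq_add] at h1
      rw [h1]
      push_cast at ht
      exact add_mem (Submodule.smul_mem _ _ (ih (t - 1) (by omega) _ (h.dec_mem _ _))) ⟨_, rfl⟩
  intro m
  change m ∈ LinearMap.range f
  induction m using h.induction with
  | homog t m hm => exact key (t - b + 1).toNat t (by omega) m hm
  | add x y hx hy => exact add_mem hx hy

end

lemma exists_bound_freeGr {σ : Type} {p : ℕ} (tw : Fin p → ℤ) :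
    ∃ b : ℤ, ∀ t < b, ∀ v ∈ freeGr k σ tw t, v = 0 := by
  obtain ⟨b, hb⟩ := (Set.finite_range tw).bddBelow
  refine ⟨b, fun t ht v hv => funext fun l => ?_⟩
  rcases hv l with h | ⟨h, _⟩
  · exact h
  · have := hb ⟨l, rfl⟩
    omega

/-- Reductions pass to kernels of maps from free modules. -/
lemma IsReduction.kernel {M M' : Type} [AddCommGroup M]
    [Module (MvPolynomial (Fin (r + 1)) k) M] [AddCommGroup M'] [Module (MvPolynomial (Fin r) k) M']
    {gr : ℤ → AddSubgroup M} {gr' : ℤ → AddSubgroup M'} {q : M →+ M'} (Q : IsReduction k r gr gr' q)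
    {p : ℕ} (tw : Fin p → ℤ)
    {f : (Fin p → MvPolynomial (Fin (r + 1)) k) →ₗ[MvPolynomial (Fin (r + 1)) k] M}
    {f' : (Fin p → MvPolynomial (Fin r) k) →ₗ[MvPolynomial (Fin r) k] M'}
    (hqf : ∀ v, q (f v) = f' fun l => redHom k r (v l)) (hf : Function.Surjective f)
    {q' : LinearMap.ker f →+ LinearMap.ker f'} (hq' : ∀ v l, (q' v).1 l = redHom k r (v.1 l)) :
    IsReduction k r (kerGr tw f) (kerGr tw f') q' := by
  refine ⟨?_, ?_, ?_, ?_, ?_, ?_⟩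
  · rintro ⟨w, hw⟩
    obtain ⟨m', hm'⟩ := Q.ker (f fun l => succHom k r (w l)) (by
      rw [hqf]; simp only [redHom_succHom]; exact hw)
    obtain ⟨u, rfl⟩ := hf m'
    refine ⟨⟨(fun l => succHom k r (w l)) - (X 0 : MvPolynomial (Fin (r + 1)) k) • u, ?_⟩, ?_⟩
    · rw [LinearMap.mem_ker, map_sub, map_smul, hm', sub_self]
    · refine Subtype.ext (funext fun l => ?_)
      rw [hq']
      change redHom k r (((fun l => succHom k r (w l)) -
        (X 0 : MvPolynomial (Fin (r + 1)) k) • u) l) = w l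
      rw [Pi.sub_apply, Pi.smul_apply, smul_eq_mul, map_sub, map_mul, redHom_succHom,
        redHom_X_zero, zero_mul, sub_zero]
  · intro a v
    refine Subtype.ext (funext fun l => ?_)
    rw [hq', Submodule.coe_smul, Submodule.coe_smul, Pi.smul_apply, Pi.smul_apply, hq', smul_eq_mul,
      smul_eq_mul, map_mul]
  · rintro ⟨v, hv⟩ h0
    have hw : ∀ l, ∃ w, v l = X 0 * w := fun l => by
      obtain ⟨w, hw⟩ := exists_eq_succHom_add (v l)
      have h1 := hq' ⟨v, hv⟩ l
      rw [h0] at h1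
      exact ⟨w, by rwa [← h1, Submodule.coe_zero, Pi.zero_apply, map_zero, zero_add] at hw⟩
    choose w hw using hw
    have hvw : v = (X 0 : MvPolynomial (Fin (r + 1)) k) • w := funext hw
    refine ⟨⟨w, Q.regular _ ?_⟩, Subtype.ext hvw⟩
    rw [← map_smul, ← hvw]; exact hv
  · intro t v hv l
    change homogZ k ((q' v).1 l) _
    rw [hq']
    exact (hv l).redHom
  · rintro ⟨v, hv⟩ h0
    refine Subtype.ext (funext fun l => ?_)
    have : X 0 * v l = 0 := congrFun (congrArg Subtype.val h0) l
    exact (mul_eq_zero.1 this).resolve_left (X_ne_zero _)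
  · obtain ⟨b, hb⟩ := exists_bound_freeGr (k := k) (σ := Fin (r + 1)) tw
    exact ⟨b, fun t ht v hv => Subtype.ext (hb t ht _ hv)⟩

/-- Resolutions lift along reductions. -/
lemma IsReduction.hasRes {n : ℕ} : ∀ {c : ℤ} {M M' : Type} [AddCommGroup M]
    [Module (MvPolynomial (Fin (r + 1)) k) M] [AddCommGroup M'] [Module (MvPolynomial (Fin r) k) M']
    {gr : ℤ → AddSubgroup M} {gr' : ℤ → AddSubgroup M'} {q : M →+ M'} (_ : IsReduction k r gr gr' q)
    (_ : IsGrading k (Fin (r + 1)) gr) (_ : IsGrading k (Fin r) gr')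
    (_ : HasRes k (Fin r) n c M' gr'), HasRes k (Fin (r + 1)) n c M gr := by
  induction n with
  | zero =>
    intro c M M' _ _ _ _ gr gr' q Q h h' hres
    have : Subsingleton M' := hres
    have hs := Q.surjective h (isGrading_freeGr (ι := Fin 0) Fin.elim0) 0
      (fun t v _ => by rw [LinearMap.zero_apply]; exact zero_mem _)
      fun m => ⟨0, Subsingleton.elim _ _⟩
    exact hs.subsingleton
  | succ n ih =>
    rintro c M M' _ _ _ _ gr gr' q Q h h' ⟨p, tw, f', h1, h2, h3, h4⟩
    have hlift : ∀ l, ∃ m ∈ gr (tw l), q m = f' (Pi.single l 1) := by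
      intro l
      obtain ⟨m, hm⟩ := Q.surj (f' (Pi.single l 1))
      rw [← hm]
      exact h.surj_degreewise h' q Q.graded (by rw [hm]; exact h2 l)
    choose s hs1 hs2 using hlift
    let f := Fintype.linearCombination (MvPolynomial (Fin (r + 1)) k) s
    have hf1 : ∀ l, f (Pi.single l 1) = s l := fun l => by
      simp [f, Fintype.linearCombination_apply_single]
    have hf2 : ∀ l, f (Pi.single l 1) ∈ gr (tw l) := fun l => by rw [hf1]; exact hs1 l
    have hqf : ∀ v, q (f v) = f' fun l => redHom k r (v l) := by
      intro v
      rw [pi_eq_sum_univ' fun l => redHom k r (v l)]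
      simp only [f, Fintype.linearCombination_apply, map_sum, map_smul, Q.map_smul', hs2]
    have hfs : Function.Surjective f := by
      refine Q.surjective h (isGrading_freeGr tw) f (freeGr_hom h hf2) fun m => ?_
      obtain ⟨v, rfl⟩ := h1 m
      exact ⟨fun l => succHom k r (v l), by simp only [hqf, redHom_succHom]⟩
    refine ⟨p, tw, f, hfs, hf2, h3, ?_⟩
    let q' : LinearMap.ker f →+ LinearMap.ker f' :=
      { toFun := fun v => ⟨fun l => redHom k r (v.1 l), by
          rw [LinearMap.mem_ker, ← hqf, v.2, map_zero]⟩
        map_zero' := Subtype.ext (by ext1 l; exact map_zero _)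
        map_add' := fun v w => Subtype.ext (by ext1 l; exact map_add _ _ _) }
    exact ih (Q.kernel tw hqf hfs (q' := q') fun _ _ => rfl) (isGrading_kerGr h hf2)
      (isGrading_kerGr h' h2) h4

/-- A module killed by the first variable is a module over the smaller polynomial ring. -/
lemma IsGrading.exists_restrict {Q : Type} [AddCommGroup Q] [Module (MvPolynomial (Fin (r + 1)) k) Q]
    [Module.Finite (MvPolynomial (Fin (r + 1)) k) Q] {gr : ℤ → AddSubgroup Q}
    (h : IsGrading k (Fin (r + 1)) gr)
    (hX : ∀ m : Q, (X 0 : MvPolynomial (Fin (r + 1)) k) • m = 0) :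
    ∃ _ : Module (MvPolynomial (Fin r) k) Q, Module.Finite (MvPolynomial (Fin r) k) Q ∧
      IsGrading k (Fin r) gr ∧
      ∀ (a : MvPolynomial (Fin (r + 1)) k) (m : Q), a • m = redHom k r a • m := by
  let _ : Module (MvPolynomial (Fin r) k) Q := Module.compHom Q (succHom k r).toRingHom
  have hred : ∀ (a : MvPolynomial (Fin (r + 1)) k) (m : Q), a • m = redHom k r a • m := by
    intro a m
    obtain ⟨w, hw⟩ := exists_eq_succHom_add a
    change _ = succHom k r (redHom k r a) • m
    conv_lhs => rw [hw, add_smul, mul_smul]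
    rw [hX, add_zero]
  refine ⟨inferInstance, ?_, ⟨h.1, fun a d t m ha hm => h.2 _ d t m ha.rename_isHomogeneous hm⟩,
    hred⟩
  obtain ⟨s, hs⟩ := Module.Finite.fg_top (R := MvPolynomial (Fin (r + 1)) k) (M := Q)
  refine ⟨⟨s, top_le_iff.1 fun m _ => ?_⟩⟩
  have hm : m ∈ Submodule.span (MvPolynomial (Fin (r + 1)) k) (s : Set Q) := by
    rw [hs]; trivial
  induction hm using Submodule.span_induction with
  | mem m hm => exact Submodule.subset_span hm
  | zero => exact zero_mem _
  | add x y _ _ hx hy => exact add_mem (hx trivial) (hy trivial)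
  | smul a m _ hm => rw [hred]; exact Submodule.smul_mem _ _ (hm trivial)

/-- The kernel of a map from a free module has a finite resolution if finite modules over the
smaller polynomial ring do. -/
lemma exists_hasRes_of_regular
    (ih : ∀ {M : Type} [AddCommGroup M] [Module (MvPolynomial (Fin r) k) M]
      [Module.Finite (MvPolynomial (Fin r) k) M] {gr : ℤ → AddSubgroup M}
      (_ : IsGrading k (Fin r) gr), ∃ n c, HasRes k (Fin r) n c M gr)
    {K : Type} [AddCommGroup K] [Module (MvPolynomial (Fin (r + 1)) k) K]
    [Module.Finite (MvPolynomial (Fin (r + 1)) k) K] {gr : ℤ → AddSubgroup K}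
    (h : IsGrading k (Fin (r + 1)) gr)
    (hreg : ∀ m : K, (X 0 : MvPolynomial (Fin (r + 1)) k) • m = 0 → m = 0)
    (hbdd : ∃ b : ℤ, ∀ t < b, ∀ m ∈ gr t, m = 0) :
    ∃ n c, HasRes k (Fin (r + 1)) n c K gr := by
  let x : MvPolynomial (Fin (r + 1)) k := X 0
  let L : Submodule (MvPolynomial (Fin (r + 1)) k) K := LinearMap.range (LinearMap.lsmul _ K x)
  have hL : ∀ m ∈ L, ∀ t, h.dec m t ∈ L := by
    rintro _ ⟨m, rfl⟩ t
    refine ⟨h.dec m (t - 1), ?_⟩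
    have := h.dec_smul (homogZ_of_isHomogeneous (isHomogeneous_X k 0)) m (t - 1)
    rw [Nat.cast_one, sub_add_cancel] at this
    exact this.symm
  obtain ⟨_, _, hgr, hred⟩ := (h.quotient L hL).exists_restrict fun m => by
    obtain ⟨m, rfl⟩ := L.mkQ_surjective m
    rw [← map_smul, Submodule.mkQ_apply, Submodule.Quotient.mk_eq_zero]
    exact ⟨m, rfl⟩
  obtain ⟨n, c, hres⟩ := ih hgr
  refine ⟨n, c, IsReduction.hasRes (q := L.mkQ.toAddMonoidHom)
    (gr' := fun t => (gr t).map L.mkQ.toAddMonoidHom)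
    ⟨L.mkQ_surjective, fun a m => (map_smul L.mkQ a m).trans (hred a _), fun m hm => ?_,
      fun t m hm => ⟨m, hm, rfl⟩, hreg, hbdd⟩ h hgr hres⟩
  obtain ⟨m', hm'⟩ := (Submodule.Quotient.mk_eq_zero L).1 hm
  exact ⟨m', hm'.symm⟩

/-- Hilbert's syzygy theorem. -/
theorem exists_hasRes (r : ℕ) : ∀ {M : Type} [AddCommGroup M] [Module (MvPolynomial (Fin r) k) M]
    [Module.Finite (MvPolynomial (Fin r) k) M] {gr : ℤ → AddSubgroup M}
    (_ : IsGrading k (Fin r) gr), ∃ n c, HasRes k (Fin r) n c M gr := by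
  induction r with
  | zero => intro M _ _ _ gr h; exact exists_hasRes_of_isEmpty h
  | succ r ih =>
    intro M _ _ _ gr h
    obtain ⟨p, tw, f, hf1, hf2⟩ := h.exists_cover
    obtain ⟨b, hb⟩ := exists_bound_freeGr (k := k) (σ := Fin (r + 1)) tw
    obtain ⟨n, c, hres⟩ := exists_hasRes_of_regular ih (isGrading_kerGr h hf2)
      (by
        rintro ⟨v, hv⟩ h0
        refine Subtype.ext (funext fun l => ?_)
        have : X 0 * v l = 0 := congrFun (congrArg Subtype.val h0) l
        exact (mul_eq_zero.1 this).resolve_left (X_ne_zero _))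
      ⟨b, fun t ht v hv => Subtype.ext (hb t ht _ hv)⟩
    obtain ⟨B, hB⟩ := (Set.finite_range tw).bddAbove
    exact ⟨n + 1, max B c, p, tw, f, hf1, hf2, fun l => (hB ⟨l, rfl⟩).trans (le_max_left _ _),
      hres.mono le_rfl (by have := le_max_right B c; omega)⟩

end reduction

section
variable {k : Type} [Field k] {σ : Type} {p q : Ideal (MvPolynomial σ k)}

section
attribute [local instance] MvPolynomial.gradedAlgebra

lemma isHomogeneousIdeal_iff :
    IsHomogeneousIdeal k q ↔ q.IsHomogeneous (homogeneousSubmodule σ k) := by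
  constructor
  · intro h m f hf
    change (DirectSum.Decomposition.decompose' (ℳ := homogeneousSubmodule σ k) f m : MvPolynomial σ k) ∈ q
    rw [decomposition.decompose'_apply]
    exact h f hf m
  · intro h f hf m
    rw [← decomposition.decompose'_apply]
    exact h m hf

lemma isHomogeneousIdeal_top : IsHomogeneousIdeal k (⊤ : Ideal (MvPolynomial σ k)) :=
  fun _ _ _ => Submodule.mem_top

lemma IsHomogeneousIdeal.sup (hp : IsHomogeneousIdeal k p) (hq : IsHomogeneousIdeal k q) :
    IsHomogeneousIdeal k (p ⊔ q) :=
  isHomogeneousIdeal_iff.2 ((isHomogeneousIdeal_iff.1 hp).sup (isHomogeneousIdeal_iff.1 hq))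

lemma IsHomogeneousIdeal.pow (hq : IsHomogeneousIdeal k q) (n : ℕ) :
    IsHomogeneousIdeal k (q ^ n) := by
  induction n with
  | zero => rw [pow_zero, Ideal.one_eq_top]; exact isHomogeneousIdeal_top
  | succ n ih =>
    exact isHomogeneousIdeal_iff.2
      ((isHomogeneousIdeal_iff.1 ih).mul (isHomogeneousIdeal_iff.1 hq))

lemma IsHomogeneousIdeal.map_rename {τ : Type} (hq : IsHomogeneousIdeal k q) (e : σ → τ) :
    IsHomogeneousIdeal k (q.map (rename e : _ →ₐ[k] MvPolynomial τ k)) := by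
  rw [isHomogeneousIdeal_iff] at hq ⊢
  obtain ⟨S, hS⟩ := (Ideal.IsHomogeneous.iff_exists _ _).1 hq
  rw [hS, Ideal.map_span]
  refine Ideal.homogeneous_span _ _ ?_
  rintro _ ⟨_, ⟨⟨f, d, hf⟩, _, rfl⟩, rfl⟩
  exact ⟨d, IsHomogeneous.rename_isHomogeneous hf⟩

end

variable (k σ) in
lemma isGrading_polyGr : IsGrading k σ (polyGr k σ) := by
  refine IsGrading.of_proj (polyProj k σ) (fun t m hm => polyProj_of_homogZ hm)
    (fun s t hst m hm => polyProj_of_homogZ_ne hm hst) (fun m => ?_) (fun p d t m hp hm => ?_)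
  · rw [← sum_homogeneousComponent m]
    exact sum_mem fun i _ => AddSubgroup.mem_iSup_of_mem (i : ℤ)
      (homogZ_of_isHomogeneous (homogeneousComponent_isHomogeneous i m))
  · rw [add_comm]
    exact (homogZ_of_isHomogeneous hp).mul hm

lemma dec_polyGr (f : MvPolynomial σ k) (t : ℤ) :
    (isGrading_polyGr k σ).dec f t = polyProj k σ t f := by
  induction f using (isGrading_polyGr k σ).induction with
  | homog s m hm =>
    rw [(isGrading_polyGr k σ).dec_of_mem hm, Finsupp.single_apply]
    split_ifs with h
    · subst h; exact (polyProj_of_homogZ hm).symm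
    · exact (polyProj_of_homogZ_ne hm (Ne.symm h)).symm
  | add x y hx hy => rw [map_add, map_add, Finsupp.add_apply, hx, hy]

lemma IsHomogeneousIdeal.dec_mem (hq : IsHomogeneousIdeal k q) :
    ∀ f ∈ q, ∀ t, (isGrading_polyGr k σ).dec f t ∈ q := by
  intro f hf t
  rw [dec_polyGr, polyProj]
  split_ifs
  · exact hq f hf _
  · exact zero_mem _

lemma quotGr_eq_map (Q : Ideal (MvPolynomial σ k)) (t : ℤ) :
    quotGr k Q t = (polyGr k σ t).map (Submodule.mkQ Q).toAddMonoidHom := by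
  rw [quotGr, ← AddSubgroup.closure_eq ((polyGr k σ t).map _)]
  congr 1
  ext x
  exact exists_congr fun f => and_congr_right fun _ => eq_comm

lemma subQuotGr_eq_map (p q : Ideal (MvPolynomial σ k)) (t : ℤ) :
    subQuotGr k p q t = ((polyGr k σ t).comap p.subtype.toAddMonoidHom).map
      (Submodule.mkQ (Submodule.comap p.subtype q)).toAddMonoidHom := by
  rw [subQuotGr, ← AddSubgroup.closure_eq (AddSubgroup.map _ _)]
  congr 1
  ext x
  exact exists_congr fun f => and_congr_right fun _ => eq_comm

lemma IsHomogeneousIdeal.isGrading_quotGr (hq : IsHomogeneousIdeal k q) :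
    IsGrading k σ (quotGr k q) := by
  rw [funext (quotGr_eq_map q)]
  exact (isGrading_polyGr k σ).quotient q hq.dec_mem

lemma IsHomogeneousIdeal.isGrading_subQuotGr (hp : IsHomogeneousIdeal k p)
    (hq : IsHomogeneousIdeal k q) : IsGrading k σ (subQuotGr k p q) := by
  rw [funext (subQuotGr_eq_map p q)]
  have h := (isGrading_polyGr k σ).submodule p hp.dec_mem
  refine h.quotient _ fun m hm t => ?_
  have := h.hom_dec (isGrading_polyGr k σ) p.subtype.toAddMonoidHom (fun _ _ h => h) m t
  change p.subtype (h.dec m t) ∈ q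
  change _ = p.subtype (h.dec m t) at this
  rw [← this]
  exact hq.dec_mem _ hm t

lemma mk_mem_quotGr {Q : Ideal (MvPolynomial σ k)} {t : ℤ} {f : MvPolynomial σ k}
    (hf : homogZ k f t) : Ideal.Quotient.mk Q f ∈ quotGr k Q t :=
  AddSubgroup.subset_closure ⟨f, hf, rfl⟩

lemma exists_of_mem_quotGr {Q : Ideal (MvPolynomial σ k)} {t : ℤ} {x : MvPolynomial σ k ⧸ Q}
    (hx : x ∈ quotGr k Q t) : ∃ f, homogZ k f t ∧ Ideal.Quotient.mk Q f = x := by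
  rw [quotGr_eq_map] at hx
  exact hx

lemma exists_of_mem_subQuotGr {t : ℤ} {x : subQuot k p q} (hx : x ∈ subQuotGr k p q t) :
    ∃ f : p, homogZ k (f : MvPolynomial σ k) t ∧ Submodule.Quotient.mk f = x := by
  rw [subQuotGr_eq_map] at hx
  exact hx

lemma subQuotIncl_mem_quotGr (t : ℤ) : ∀ x ∈ subQuotGr k p q t, subQuotIncl p q x ∈ quotGr k q t := by
  intro x hx
  obtain ⟨f, hf, rfl⟩ := exists_of_mem_subQuotGr hx
  exact mk_mem_quotGr hf

lemma factor_mem_quotGr (h : q ≤ p) (t : ℤ) :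
    ∀ x ∈ quotGr k q t, Submodule.factor h x ∈ quotGr k p t := by
  intro x hx
  obtain ⟨f, hf, rfl⟩ := exists_of_mem_quotGr hx
  exact mk_mem_quotGr hf

lemma powFilIncl_mem_quotGr {τ : Type} (I : Ideal (MvPolynomial σ k))
    (J : Ideal (MvPolynomial τ k)) {n a m : ℕ} (h : n = a + m) (t : ℤ) :
    ∀ x ∈ extGr k σ τ (subQuotGr k (I ^ a) (I ^ (a + 1))) (quotGr k (J ^ m)) t,
      powFilIncl I J h x ∈ quotGr k (powFil I J n (a + 1)) t := by
  refine map_mem_of_mem_extGr (powFilIncl I J h).toAddMonoidHom (fun a b x hx y hy => ?_) t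
  obtain ⟨f, hf, rfl⟩ := exists_of_mem_subQuotGr hx
  obtain ⟨g, hg, rfl⟩ := exists_of_mem_quotGr hy
  exact mk_mem_quotGr ((hf.rename _).mul (hg.rename _))

lemma IsHomogeneousIdeal.powFil {τ : Type} {I : Ideal (MvPolynomial σ k)}
    {J : Ideal (MvPolynomial τ k)} (hI : IsHomogeneousIdeal k I) (hJ : IsHomogeneousIdeal k J)
    (n a : ℕ) : IsHomogeneousIdeal k (powFil I J n a) :=
  (((hI.map_rename _).sup (hJ.map_rename _)).pow n).sup ((hI.pow a).map_rename _)

lemma eq_zero_of_mem_quotGr {t : ℤ} (ht : t < 0) : ∀ x ∈ quotGr k q t, x = 0 := by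
  intro x hx
  obtain ⟨f, rfl | ⟨h, _⟩, rfl⟩ := exists_of_mem_quotGr hx
  · exact map_zero _
  · omega

lemma eq_zero_of_mem_subQuotGr {t : ℤ} (ht : t < 0) : ∀ x ∈ subQuotGr k p q t, x = 0 := by
  intro x hx
  refine subQuotIncl_injective ?_
  rw [map_zero, eq_zero_of_mem_quotGr ht _ (subQuotIncl_mem_quotGr t x hx)]

section regularity
variable {M : Type} [AddCommGroup M] [Module (MvPolynomial σ k) M] {gr : ℤ → AddSubgroup M}

lemma GradedFreeRes.exists_nonneg_tw [Nontrivial M] (h0 : ∀ t < 0, ∀ x ∈ gr t, x = 0)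
    (F : GradedFreeRes k σ M gr) : ∃ l, 0 ≤ F.tw 0 l := by
  by_contra! h
  have : F.aug = 0 := LinearMap.pi_ext' fun l => LinearMap.ext_ring (by
    simpa using h0 _ (h l) _ (F.aug_homog l))
  obtain ⟨m, hm⟩ := exists_ne (0 : M)
  obtain ⟨v, rfl⟩ := F.aug_surj m
  rw [this] at hm
  exact hm rfl

lemma bddBelow_regM [Nontrivial M] (h0 : ∀ t < 0, ∀ x ∈ gr t, x = 0) :
    BddBelow {r : ℤ | ∃ F : GradedFreeRes k σ M gr,
      ∀ i (l : Fin (F.rk i)), F.tw i l - (i : ℤ) ≤ r} := by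
  refine ⟨0, ?_⟩
  rintro c ⟨F, hF⟩
  obtain ⟨l, hl⟩ := F.exists_nonneg_tw h0
  have := hF 0 l
  rw [Nat.cast_zero, sub_zero] at this
  exact hl.trans this

lemma HasRes.regM_le {n : ℕ} {c : ℤ} [Nontrivial M] (h0 : ∀ t < 0, ∀ x ∈ gr t, x = 0)
    (h : HasRes k σ n c M gr) : regM k σ M gr ≤ c :=
  csInf_le (bddBelow_regM h0) h.exists_gradedFreeRes

/-- The regularity is attained by a resolution. -/
lemma IsGrading.hasRes_regM {r : ℕ} {M : Type} [AddCommGroup M] [Module (MvPolynomial (Fin r) k) M]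
    [Module.Finite (MvPolynomial (Fin r) k) M] [Nontrivial M] {gr : ℤ → AddSubgroup M}
    (h : IsGrading k (Fin r) gr) (h0 : ∀ t < 0, ∀ x ∈ gr t, x = 0) :
    ∃ n, HasRes k (Fin r) n (regM k (Fin r) M gr) M gr := by
  obtain ⟨n, c, hc⟩ := exists_hasRes r h
  obtain ⟨F, hF⟩ := Int.csInf_mem ⟨c, hc.exists_gradedFreeRes⟩ (bddBelow_regM h0)
  obtain ⟨N, hN⟩ := F.bdd
  exact ⟨N, hasRes_of_gradedFreeRes F hN hF⟩

end regularity

lemma pow_succ_ne_pow [Finite σ] {I : Ideal (MvPolynomial σ k)} (h0 : I ≠ ⊥) (h1 : I ≠ ⊤) (i : ℕ) :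
    ¬ I ^ i ≤ I ^ (i + 1) := by
  intro h
  have hle : ∀ j, I ^ i ≤ I ^ j := by
    intro j
    induction j with
    | zero => rw [pow_zero, Ideal.one_eq_top]; exact le_top
    | succ j ih =>
      calc I ^ i ≤ I ^ i * I := by rw [← pow_succ]; exact h
        _ ≤ I ^ j * I := Ideal.mul_mono_left ih
        _ = I ^ (j + 1) := (pow_succ I j).symm
  have hb := le_iInf hle
  rw [Ideal.iInf_pow_eq_bot_of_isDomain I h1, le_bot_iff] at hb
  exact pow_ne_zero i h0 hb

lemma nontrivial_subQuot_pow [Finite σ] {I : Ideal (MvPolynomial σ k)} (h0 : I ≠ ⊥) (h1 : I ≠ ⊤)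
    (i : ℕ) : Nontrivial (subQuot k (I ^ i) (I ^ (i + 1))) := by
  refine Submodule.Quotient.nontrivial_iff.2 fun h => pow_succ_ne_pow h0 h1 i ?_
  rwa [Submodule.comap_subtype_eq_top] at h

lemma exists_hasRes_regSubQuot {r : ℕ} {I : Ideal (MvPolynomial (Fin r) k)} (h0 : I ≠ ⊥)
    (h1 : I ≠ ⊤) (hh : IsHomogeneousIdeal k I) (i : ℕ) :
    ∃ n, HasRes k (Fin r) n (regSubQuot k (I ^ i) (I ^ (i + 1))) (subQuot k (I ^ i) (I ^ (i + 1)))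
      (subQuotGr k (I ^ i) (I ^ (i + 1))) := by
  have := nontrivial_subQuot_pow h0 h1 i
  exact ((hh.pow i).isGrading_subQuotGr (hh.pow (i + 1))).hasRes_regM
    fun t ht => eq_zero_of_mem_subQuotGr ht

lemma HasRes.quot_pow {J : Ideal (MvPolynomial σ k)} (hJ : IsHomogeneousIdeal k J) {c : ℤ} (m : ℕ)
    (h : ∀ j < m, ∃ n, HasRes k σ n c (subQuot k (J ^ j) (J ^ (j + 1)))
      (subQuotGr k (J ^ j) (J ^ (j + 1)))) :
    ∃ n, HasRes k σ n c (MvPolynomial σ k ⧸ J ^ m) (quotGr k (J ^ m)) := by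
  induction m with
  | zero =>
    have : Subsingleton (MvPolynomial σ k ⧸ J ^ 0) := by
      rw [Ideal.Quotient.subsingleton_iff, pow_zero, Ideal.one_eq_top]
    exact ⟨0, this⟩
  | succ m ih =>
    obtain ⟨n, hn⟩ := h m m.lt_succ_self
    obtain ⟨n', hn'⟩ := ih fun j hj => h j (hj.trans m.lt_succ_self)
    have hle : J ^ (m + 1) ≤ J ^ m := Ideal.pow_le_pow_right m.le_succ
    exact ⟨max n n', HasRes.extension ((hJ.pow m).isGrading_subQuotGr (hJ.pow (m + 1)))
      (hJ.pow (m + 1)).isGrading_quotGr (hJ.pow m).isGrading_quotGr (subQuotIncl _ _)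
      (Submodule.factor hle) subQuotIncl_mem_quotGr (factor_mem_quotGr hle)
      subQuotIncl_injective (Submodule.factor_surjective hle) (exact_subQuotIncl hle)
      (hn.mono (le_max_left _ _) le_rfl) (hn'.mono (le_max_right _ _) le_rfl)⟩

end

section
variable {k : Type} [Field k] {r s : ℕ}

lemma exists_hasRes_sumIJ_pow {I : Ideal (PA k r)} {J : Ideal (PB k s)} (hI0 : I ≠ ⊥) (hI1 : I ≠ ⊤)
    (hIh : IsHomogeneousIdeal k I) (hJ0 : J ≠ ⊥) (hJ1 : J ≠ ⊤) (hJh : IsHomogeneousIdeal k J)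
    (n : ℕ) (c : ℤ) (h : ∀ i j : ℕ, i + j + 1 ≤ n →
      regSubQuot k (I ^ i) (I ^ (i + 1)) + regSubQuot k (J ^ j) (J ^ (j + 1)) ≤ c) :
    ∃ N, HasRes k (Fin r ⊕ Fin s) N c (PR k r s ⧸ (sumIJ k I J) ^ n)
      (quotGr k ((sumIJ k I J) ^ n)) := by
  suffices ∀ a ≤ n, ∃ N, HasRes k (Fin r ⊕ Fin s) N c (PR k r s ⧸ powFil I J n a)
      (quotGr k (powFil I J n a)) by
    have h1 := this n le_rfl
    rwa [powFil_self] at h1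
  intro a ha
  induction a with
  | zero =>
    have : Subsingleton (PR k r s ⧸ powFil I J n 0) := by
      rw [Ideal.Quotient.subsingleton_iff, powFil_zero]
    exact ⟨0, this⟩
  | succ a ih =>
    obtain ⟨m, rfl⟩ : ∃ m, n = a + m := ⟨n - a, by omega⟩
    obtain ⟨N, hN⟩ := ih (by omega)
    obtain ⟨N₁, h₁⟩ := exists_hasRes_regSubQuot hI0 hI1 hIh a
    obtain ⟨N₂, h₂⟩ := HasRes.quot_pow hJh (c := c - regSubQuot k (I ^ a) (I ^ (a + 1))) m
      fun j hj => by
        obtain ⟨N₃, h₃⟩ := exists_hasRes_regSubQuot hJ0 hJ1 hJh j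
        exact ⟨N₃, h₃.mono le_rfl (by have := h a j (by omega); linarith)⟩
    have GI := (hIh.pow a).isGrading_subQuotGr (hIh.pow (a + 1))
    have GJ := (hJh.pow m).isGrading_quotGr
    have h₄ := HasRes.extT GI GJ h₁ h₂
    rw [add_sub_cancel] at h₄
    exact ⟨max (N₁ + N₂) N, HasRes.extension (GI.extT GJ)
      (hIh.powFil hJh _ _).isGrading_quotGr (hIh.powFil hJh _ _).isGrading_quotGr
      (powFilIncl I J rfl) (Submodule.factor (powFil_succ_le I J))
      (powFilIncl_mem_quotGr I J rfl) (factor_mem_quotGr _) (powFilIncl_injective I J rfl)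
      (Submodule.factor_surjective _) (exact_powFilIncl I J rfl)
      (h₄.mono (le_max_left _ _) le_rfl) (hN.mono (le_max_right _ _) le_rfl)⟩

lemma sumIJ_pow_ne_top {I : Ideal (PA k r)} {J : Ideal (PB k s)} (hI1 : I ≠ ⊤)
    (hIh : IsHomogeneousIdeal k I) (hJ1 : J ≠ ⊤) (hJh : IsHomogeneousIdeal k J)
    {n : ℕ} (hn : 1 ≤ n) : (sumIJ k I J) ^ n ≠ ⊤ := fun h =>
  maxHomIdeal_ne_top (top_le_iff.1 (h ▸ sumIJ_pow_le_maxHomIdeal hI1 hIh hJ1 hJh hn))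

lemma reg_bound (I : Ideal (PA k r)) (J : Ideal (PB k s)) (hI0 : I ≠ ⊥) (hI1 : I ≠ ⊤)
    (hIh : IsHomogeneousIdeal k I) (hJ0 : J ≠ ⊥) (hJ1 : J ≠ ⊤) (hJh : IsHomogeneousIdeal k J)
    (n : ℕ) (hn : 1 ≤ n) :
    regQuot k ((sumIJ k I J) ^ n) ≤
      sSup {v : ℤ | ∃ i j : ℕ, i + j ≤ n - 1 ∧
        v = regSubQuot k (I ^ i) (I ^ (i + 1)) + regSubQuot k (J ^ j) (J ^ (j + 1))} := by
  have hbdd : BddAbove {v : ℤ | ∃ i j : ℕ, i + j ≤ n - 1 ∧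
      v = regSubQuot k (I ^ i) (I ^ (i + 1)) + regSubQuot k (J ^ j) (J ^ (j + 1))} := by
    refine (((Set.finite_Iic n).prod (Set.finite_Iic n)).image fun x : ℕ × ℕ =>
      regSubQuot k (I ^ x.1) (I ^ (x.1 + 1)) +
        regSubQuot k (J ^ x.2) (J ^ (x.2 + 1))).bddAbove.mono ?_
    rintro _ ⟨i, j, hij, rfl⟩
    exact ⟨(i, j), ⟨Set.mem_Iic.2 (by omega), Set.mem_Iic.2 (by omega)⟩, rfl⟩
  have := Ideal.Quotient.nontrivial_iff.2 (sumIJ_pow_ne_top hI1 hIh hJ1 hJh hn)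
  obtain ⟨N, hN⟩ := exists_hasRes_sumIJ_pow hI0 hI1 hIh hJ0 hJ1 hJh n _
    fun i j hij => le_csSup hbdd ⟨i, j, by omega, rfl⟩
  exact hN.regM_le fun t ht => eq_zero_of_mem_quotGr ht

end

end PaperHTT
end

open PaperHTT in
/-- Corollary 3.4: for `n ≥ 1`,
(i) `depth R/(I+J)^n ≥ min_(i+j ≤ n-1) (depth I^i/I^(i+1) + depth J^j/J^(j+1))` and
(ii) `reg R/(I+J)^n ≤ max_(i+j ≤ n-1) (reg I^i/I^(i+1) + reg J^j/J^(j+1))`. -/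
theorem depth_reg_quot_bounds
    (k : Type) [Field k] (r s : ℕ)
    (I : Ideal (PA k r)) (J : Ideal (PB k s))
    (hI0 : I ≠ ⊥) (hI1 : I ≠ ⊤) (hIh : IsHomogeneousIdeal k I)
    (hJ0 : J ≠ ⊥) (hJ1 : J ≠ ⊤) (hJh : IsHomogeneousIdeal k J)
    (n : ℕ) (hn : 1 ≤ n) :
    sInf {v : ℕ | ∃ i j : ℕ, i + j ≤ n - 1 ∧
        v = depthSubQuot k (I ^ i) (I ^ (i + 1)) + depthSubQuot k (J ^ j) (J ^ (j + 1))} ≤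
      depthQuot k ((sumIJ k I J) ^ n) ∧
    regQuot k ((sumIJ k I J) ^ n) ≤
      sSup {v : ℤ | ∃ i j : ℕ, i + j ≤ n - 1 ∧
        v = regSubQuot k (I ^ i) (I ^ (i + 1)) + regSubQuot k (J ^ j) (J ^ (j + 1))} :=
  ⟨depth_bound I J hI1 hIh hJ1 hJh n hn, reg_bound I J hI0 hI1 hIh hJ0 hJ1 hJh n hn⟩
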